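/- arXiv:math/0209074 — 6 statements merged into one kernel-verified Lean document; each statement's English description precedes it below -/
import Mathlib

section
/- Let f : X → Y be a perfect surjection between paracompact Hausdorff spaces such that dim f ≤ n and dim Y ≤ m, and let ω be an open cover of X. Then the set {g ∈ C(X, I^{2n+1+m}) : f × g is an ω-map} is open and dense in C(X, I^{2n+1+m}) with the source limitation topology. -/
open Set Topology

noncomputable section

/-- The `k`-dimensional cube `I^k`, viewed inside Euclidean space with the Euclidean metric. -/
def cube (k : ℕ) : Set (EuclideanSpace ℝ (Fin k)) := {x | ∀ i, x i ∈ Set.Icc (0:ℝ) 1}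

/-- The Hilbert cube `I^∞`, embedded in `ℓ²` as a closed convex subset; its metric `d_∞` is the
one induced by the `ℓ²` norm. -/
def HilbertCube : Set (lp (fun _ : ℕ => ℝ) 2) :=
  {x | ∀ i : ℕ, (x : ℕ → ℝ) i ∈ Set.Icc (0:ℝ) (1 / 2 ^ i)}

/-- Covering dimension of a topological space is at most `n` (as an integer, so that `n ≤ -1`
means the space is empty): every finite open cover admits an open shrinking of order `≤ n + 1`. -/
def CovDimLE (X : Type*) [TopologicalSpace X] (n : ℤ) : Prop :=
  ∀ (ι : Type) (U : ι → Set X), Finite ι → (∀ i, IsOpen (U i)) → (⋃ i, U i) = Set.univ →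
    ∃ V : ι → Set X, (∀ i, IsOpen (V i)) ∧ (∀ i, V i ⊆ U i) ∧ (⋃ i, V i) = Set.univ ∧
      ∀ x : X, (({i | x ∈ V i}).ncard : ℤ) ≤ n + 1

/-- A perfect map: continuous, closed, with compact fibers. -/
def IsPerfectMap {X Y : Type*} [TopologicalSpace X] [TopologicalSpace Y] (f : X → Y) : Prop :=
  Continuous f ∧ IsClosedMap f ∧ ∀ y : Y, IsCompact (f ⁻¹' {y})

/-- `f` has countable (functional) weight: there is a continuous `h : X → I^∞` such that the
diagonal product `f × h` embeds `X` into `Y × I^∞`. -/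
def HasCountableFunctionalWeight {X Y : Type*} [TopologicalSpace X] [TopologicalSpace Y]
    (f : X → Y) : Prop :=
  ∃ h : C(X, ↥HilbertCube), IsEmbedding (fun x => (f x, h x) : X → Y × ↥HilbertCube)

/-- `h` restricted to `A` is an `ω`-map: every point of `A` has a neighborhood `V` of its image
whose preimage within `A` is contained in some member of `ω`. -/
def IsOmegaMapOn {X Z : Type*} [TopologicalSpace X] [TopologicalSpace Z]
    (ω : Set (Set X)) (h : X → Z) (A : Set X) : Prop :=
  ∀ x ∈ A, ∃ V ∈ nhds (h x), ∃ W ∈ ω, A ∩ h ⁻¹' V ⊆ W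

/-- A set `U ⊆ C(X, M)` is open in the source limitation (fine) topology: every `g ∈ U` admits a
continuous `α : X → (0, ∞)` with `B̄(g, α) ⊆ U`. -/
def SLOpen {X M : Type*} [TopologicalSpace X] [PseudoMetricSpace M] (U : Set C(X, M)) : Prop :=
  ∀ g ∈ U, ∃ α : C(X, ℝ), (∀ x, 0 < α x) ∧
    {h : C(X, M) | ∀ x, dist (g x) (h x) ≤ α x} ⊆ U

/-- A set `D ⊆ C(X, M)` is dense in the source limitation topology. -/
def SLDense {X M : Type*} [TopologicalSpace X] [PseudoMetricSpace M] (D : Set C(X, M)) : Prop :=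
  ∀ U : Set C(X, M), SLOpen U → U.Nonempty → (U ∩ D).Nonempty

/-- A set `D ⊆ C(X, M)` is a `G_δ`-set in the source limitation topology. -/
def SLGdelta {X M : Type*} [TopologicalSpace X] [PseudoMetricSpace M] (D : Set C(X, M)) : Prop :=
  ∃ F : ℕ → Set C(X, M), (∀ i, SLOpen (F i)) ∧ D = ⋂ i, F i

/-- `Y` is a `C`-space: for every sequence `ω` of open covers there are pairwise disjoint open
families `γ i`, with `γ i` refining `ω i`, whose union covers `Y`. -/
def IsCSpace (Y : Type*) [TopologicalSpace Y] : Prop :=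
  ∀ ω : ℕ → Set (Set Y), (∀ i, ∀ U ∈ ω i, IsOpen U) → (∀ i, ⋃₀ ω i = Set.univ) →
    ∃ γ : ℕ → Set (Set Y),
      (∀ i, ∀ U ∈ γ i, IsOpen U) ∧
      (∀ i, (γ i).Pairwise Disjoint) ∧
      (∀ i, ∀ U ∈ γ i, ∃ W ∈ ω i, U ⊆ W) ∧
      ⋃₀ (⋃ i, γ i) = Set.univ

/-- A closed set `F` in a metric space `M` is a `Z_m`-set: the maps `I^m → M` avoiding `F` are
dense in the space of maps `I^m → M` with the uniform convergence (sup-metric) topology. -/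
def IsZSet {M : Type*} [PseudoMetricSpace M] (m : ℕ) (F : Set M) : Prop :=
  IsClosed F ∧ Dense {u : BoundedContinuousFunction ↥(cube m) M | ∀ z, u z ∉ F}

/-- A `σZ_m`-set: a countable union of closed `Z_m`-sets. -/
def IsSigmaZSet {M : Type*} [PseudoMetricSpace M] (m : ℕ) (S : Set M) : Prop :=
  ∃ F : ℕ → Set M, (∀ i, IsZSet m (F i)) ∧ S = ⋃ i, F i

/-- A `k`-plane in `ℝ^p`: the set where `p - k` fixed coordinates take fixed real values. -/
def IsPlane (p k : ℕ) (P : Set (EuclideanSpace ℝ (Fin p))) : Prop :=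
  ∃ (s : Finset (Fin p)) (r : Fin p → ℝ), s.card = p - k ∧
    P = {x | ∀ i ∈ s, x i = r i}

/-- A rational `k`-plane in `ℝ^p`: the fixed coordinate values are rational. -/
def IsRatPlane (p k : ℕ) (P : Set (EuclideanSpace ℝ (Fin p))) : Prop :=
  ∃ (s : Finset (Fin p)) (r : Fin p → ℚ), s.card = p - k ∧
    P = {x | ∀ i ∈ s, x i = (r i : ℝ)}

/-- Condition (R): `dim (g(f⁻¹(y)) ∩ Π) ≤ k - n - 1` for every `y ∈ Y` and every rational
`k`-plane `Π` in `ℝ^{2n+1+m}` with `0 ≤ k ≤ 2n`. -/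
def ConditionR {X Y : Type*} [TopologicalSpace X] [TopologicalSpace Y]
    (f : X → Y) (n m : ℕ) (g : X → ↥(cube (2*n+1+m))) : Prop :=
  ∀ y : Y, ∀ k : ℕ, k ≤ 2*n → ∀ P : Set (EuclideanSpace ℝ (Fin (2*n+1+m))),
    IsRatPlane (2*n+1+m) k P →
    CovDimLE ↥(((fun x => ((g x : EuclideanSpace ℝ (Fin (2*n+1+m))))) '' (f ⁻¹' {y})) ∩ P)
      ((k : ℤ) - n - 1)

/-- The restriction `f|B` is σ-perfect with countable weight: `B = ⋃ᵢ Bᵢ` with `Bᵢ ⊆ X` closed,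
`f(Bᵢ) ⊆ Y` closed, and each `f|Bᵢ : Bᵢ → f(Bᵢ)` a perfect map of countable weight. -/
def SigmaPerfectCW {X Y : Type*} [TopologicalSpace X] [TopologicalSpace Y]
    (f : X → Y) (B : Set X) : Prop :=
  ∃ Bi : ℕ → Set X, B = ⋃ i, Bi i ∧ ∀ i : ℕ,
    IsClosed (Bi i) ∧ IsClosed (f '' Bi i) ∧
    IsPerfectMap ((Set.mapsTo_image f (Bi i)).restrict f (Bi i) (f '' Bi i)) ∧
    HasCountableFunctionalWeight ((Set.mapsTo_image f (Bi i)).restrict f (Bi i) (f '' Bi i))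

theorem generic_dense {L T E : Type*} [Fintype L] [NormedAddCommGroup T] [NormedSpace ℝ T]
    [FiniteDimensional ℝ T] [NormedAddCommGroup E] [NormedSpace ℝ E] [FiniteDimensional ℝ E]
    (n : ℕ) (b : L → T → E) (hb : ∀ l, ContDiff ℝ 1 (b l))
    (hdim : Module.finrank ℝ T + 2 * n < Module.finrank ℝ E) :
    Dense {a : L → E | ∀ (t : T) (c : L → ℝ), ∑ l, c l = 0 → {l | c l ≠ 0}.ncard ≤ 2 * n + 2 →
      c ≠ 0 → ∑ l, c l • (b l t + a l) ≠ 0} := by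
  classical
  let Φ : (q : L × L × Finset L) → (T × (q.2.2 → ℝ) × ({l // l ≠ q.1} → E)) → (L → E) :=
    fun q z l => if h : l ≠ q.1 then z.2.2 ⟨l, h⟩ else
      if h1 : q.2.1 ≠ q.1 then
        - b q.1 z.1 + (b q.2.1 z.1 + z.2.2 ⟨q.2.1, h1⟩) +
          ∑ r : q.2.2, if h2 : (r : L) ≠ q.1 then
            z.2.1 r • ((b r z.1 + z.2.2 ⟨r, h2⟩) - (b q.2.1 z.1 + z.2.2 ⟨q.2.1, h1⟩)) else 0
      else 0
  have hΦ : ∀ q, ContDiff ℝ 1 (Φ q) := by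
    intro q
    rw [contDiff_pi]
    intro l
    simp only [Φ]
    split_ifs with h h1
    · fun_prop
    · have := hb
      refine ContDiff.add (by fun_prop) (ContDiff.sum fun r _ => ?_)
      split_ifs with h2
      · refine ContDiff.smul (by fun_prop) (by fun_prop)
      · fun_prop
    · fun_prop
  have key : {a : L → E | ∀ (t : T) (c : L → ℝ), ∑ l, c l = 0 →
      {l | c l ≠ 0}.ncard ≤ 2 * n + 2 → c ≠ 0 → ∑ l, c l • (b l t + a l) ≠ 0}ᶜ ⊆
      ⋃ q : {q : L × L × Finset L // q.2.2.card ≤ 2 * n}, range (Φ q.1) := by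
    intro a ha
    simp only [mem_compl_iff, mem_setOf_eq, not_forall, not_not] at ha
    obtain ⟨t, c, hc0, hcard, hc, hsum⟩ := ha
    obtain ⟨l0, hl0⟩ := Function.ne_iff.1 hc
    simp only [Pi.zero_apply] at hl0
    obtain ⟨l1, hl1, hl10⟩ : ∃ l1, c l1 ≠ 0 ∧ l1 ≠ l0 := by
      by_contra! hcon
      rw [Finset.sum_eq_single l0 (fun l _ hl => by
        by_contra h; exact hl (hcon l h)) (by simp)] at hc0
      exact hl0 hc0
    set s : Finset L := Finset.univ.filter (fun l => c l ≠ 0) with hs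
    have hs' : s.card ≤ 2 * n + 2 := by
      rw [Set.ncard_eq_toFinset_card'] at hcard
      simpa [hs] using hcard
    set R : Finset L := (s.erase l0).erase l1 with hR
    have hl0s : l0 ∈ s := by simp [hs, hl0]
    have hl1s : l1 ∈ s.erase l0 := by simp [hs, hl1, hl10]
    have hRc : R.card ≤ 2 * n := by
      rw [hR, Finset.card_erase_of_mem hl1s, Finset.card_erase_of_mem hl0s]; omega
    have split : ∀ F : L → E, (∀ l, c l = 0 → F l = 0) →
        ∑ l, F l = F l0 + (F l1 + ∑ l ∈ R, F l) := by
      intro F hF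
      rw [hR, Finset.add_sum_erase _ _ hl1s, Finset.add_sum_erase _ _ hl0s, hs,
        Finset.sum_filter]
      refine Finset.sum_congr rfl fun l _ => ?_
      by_cases h : c l = 0 <;> simp [h, hF]
    have splitR : ∑ l, c l = c l0 + (c l1 + ∑ l ∈ R, c l) := by
      rw [hR, Finset.add_sum_erase _ _ hl1s, Finset.add_sum_erase _ _ hl0s, hs,
        Finset.sum_filter]
      refine Finset.sum_congr rfl fun l _ => ?_
      by_cases h : c l = 0 <;> simp [h]
    rw [mem_iUnion]
    refine ⟨⟨(l0, l1, R), hRc⟩, (t, fun r => - c r / c l0, fun l => a l), ?_⟩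
    ext1 l
    simp only [Φ]
    split_ifs with h
    · rfl
    · push Not at h
      subst h
      rw [split (fun l => c l • (b l t + a l)) (by intro l h; simp [h])] at hsum
      have h3 : ∑ r : R, (if h2 : (r : L) ≠ l then
            (- c r / c l) • ((b r t + a r) - (b l1 t + a l1)) else 0) =
          ∑ r ∈ R, (- c r / c l) • ((b r t + a r) - (b l1 t + a l1)) := by
        rw [← Finset.sum_coe_sort R]
        refine Finset.sum_congr rfl fun r _ => ?_
        have : (r : L) ≠ l := by
          have := r.2
          simp only [hR, Finset.mem_erase] at this
          exact this.2.1
        simp [this]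
      rw [h3]
      have h4 : ∑ r ∈ R, (- c r / c l) • ((b r t + a r) - (b l1 t + a l1)) =
          (-(c l)⁻¹) • (∑ r ∈ R, c r • (b r t + a r)) + ((c l)⁻¹ * ∑ r ∈ R, c r) •
            (b l1 t + a l1) := by
        rw [Finset.smul_sum, Finset.mul_sum, Finset.sum_smul, ← Finset.sum_add_distrib]
        refine Finset.sum_congr rfl fun r _ => ?_
        rw [smul_sub, smul_smul, sub_eq_add_neg, ← neg_smul]
        congr 2 <;> ring
      have h5 : ∑ r ∈ R, c r • (b r t + a r) = - (c l • (b l t + a l)) - c l1 • (b l1 t + a l1) := by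
        have := hsum
        rw [← add_assoc] at this
        rw [eq_neg_of_add_eq_zero_right this]; abel
      have h6 : ∑ r ∈ R, c r = - c l - c l1 := by linarith
      rw [h4, h5, h6, smul_sub, smul_neg, smul_smul, smul_smul]
      have e1 : -(c l)⁻¹ * c l = -1 := by field_simp
      have e2 : (c l)⁻¹ * (- c l - c l1) = -1 + -(c l)⁻¹ * c l1 := by field_simp; ring
      rw [e1, e2, add_smul]
      simp only [neg_smul, one_smul]
      abel
  have hd : Dense (⋃ q : {q : L × L × Finset L // q.2.2.card ≤ 2 * n}, range (Φ q.1))ᶜ := by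
    by_cases hL : IsEmpty L
    · have : IsEmpty {q : L × L × Finset L // q.2.2.card ≤ 2 * n} :=
        ⟨fun q => hL.elim q.1.1⟩
      simp
    rw [not_isEmpty_iff] at hL
    apply dense_compl_of_dimH_lt_finrank
    rw [dimH_iUnion]
    refine lt_of_le_of_lt (b := ((Module.finrank ℝ (L → E) - 1 : ℕ) : ENNReal))
      (iSup_le fun q => ?_) ?_
    · refine ((hΦ q.1).dimH_range_le).trans ?_
      norm_cast
      have h1 : Fintype.card {l // l ≠ q.1.1} + 1 = Fintype.card L := by
        simp [Fintype.card_subtype_compl]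
        have := Fintype.card_pos (α := L)
        omega
      have := q.2
      rw [Module.finrank_prod, Module.finrank_prod, Module.finrank_pi, Module.finrank_pi_fintype,
        Module.finrank_pi_fintype]
      simp only [Finset.sum_const, Finset.card_univ, smul_eq_mul, Fintype.card_coe]
      rw [← h1]
      have : Module.finrank ℝ T + (q.1.2.2.card) + 1 ≤ Module.finrank ℝ E := by omega
      rw [add_mul]
      omega
    · norm_cast
      have : 0 < Module.finrank ℝ (L → E) := by
        rw [Module.finrank_pi_fintype]
        simp only [Finset.sum_const, Finset.card_univ, smul_eq_mul]
        have := Fintype.card_pos (α := L)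
        exact Nat.mul_pos this (by omega)
      omega
  exact hd.mono (by rw [compl_subset_comm]; exact key)

theorem exists_exhaustion {Y : Type*} [TopologicalSpace Y] [NormalSpace Y] [ParacompactSpace Y]
    (O : ℕ → Set Y) (hO : ∀ d, IsOpen (O d)) (hcov : ⋃ d, O d = univ) :
    ∃ s : Y → ℝ, Continuous s ∧ (∀ y, 0 ≤ s y) ∧ ∀ y (d : ℕ), s y ≤ d → ∃ e < d + 1, y ∈ O e := by
  obtain ⟨ρ, hρ⟩ := PartitionOfUnity.exists_isSubordinate (isClosed_univ (X := Y)) O hO hcov.ge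
  refine ⟨fun y => ∑ᶠ e, ρ e y • (e : ℝ), ?_, ?_, ?_⟩
  · exact hρ.continuous_finsum_smul hO (fun i => continuousOn_const)
  · intro y
    exact finsum_nonneg fun e => mul_nonneg (ρ.nonneg e y) (Nat.cast_nonneg e)
  · intro y d hd
    by_contra! hcon
    simp only at hd
    have h1 : ∀ e ∈ ρ.finsupport y, d + 1 ≤ e := by
      intro e he
      by_contra! hlt
      refine hcon e hlt (hρ e (subset_tsupport _ ?_))
      exact (ρ.mem_finsupport y).1 he
    rw [← ρ.sum_finsupport_smul_eq_finsum (fun e _ => (e : ℝ))] at hd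
    have h2 : ∑ e ∈ ρ.finsupport y, ρ e y * ((d : ℝ) + 1) ≤ ∑ e ∈ ρ.finsupport y, ρ e y • (e : ℝ) := by
      refine Finset.sum_le_sum fun e he => ?_
      have := h1 e he
      have h3 : (d : ℝ) + 1 ≤ e := by exact_mod_cast this
      rw [smul_eq_mul]
      exact mul_le_mul_of_nonneg_left h3 (ρ.nonneg e y)
    rw [← Finset.sum_mul, ρ.sum_finsupport (mem_univ y)] at h2
    linarith

theorem dowker_countable {Y : Type*} [TopologicalSpace Y] [NormalSpace Y] [ParacompactSpace Y]
    (m : ℕ) (hdim : CovDimLE Y m)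
    (O : ℕ → Set Y) (hO : ∀ d, IsOpen (O d)) (hcov : ⋃ d, O d = univ) :
    ∃ V : ℕ → Set Y, (∀ d, IsOpen (V d)) ∧ (∀ d, V d ⊆ O d) ∧ (⋃ d, V d = univ) ∧
      ∀ y, {d | y ∈ V d}.encard ≤ (m + 1 : ℕ) := by
  obtain ⟨s, hs, hs0, hsO⟩ := exists_exhaustion O hO hcov
  let Inv : ℕ → (ℕ → Set Y) → Prop := fun d U =>
    (∀ e, IsOpen (U e)) ∧ (∀ e, U e ⊆ O e) ∧
    (∀ d' : ℕ, ∃ b : ℕ, ∀ y, s y ≤ d' → ∃ e < b, y ∈ U e) ∧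
    (∀ y, s y < d → {e | y ∈ U e}.encard ≤ (m + 1 : ℕ))
  have step : ∀ d U, Inv d U → ∃ U', Inv (d + 1) U' ∧
      ∀ e y, s y < d → (y ∈ U' e ↔ y ∈ U e) := by
    rintro d U ⟨h1, h2, h3, h4⟩
    obtain ⟨b, hb⟩ := h3 (d + 1)
    obtain ⟨W, hWo, hWs, hWc, hW⟩ := hdim (Option (Fin b))
      (fun i => i.elim {y | s y < d ∨ d + 1 < s y} (fun e => U e)) inferInstance
      (by
        rintro (_ | e)
        · exact (isOpen_lt hs continuous_const).union (isOpen_lt continuous_const hs)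
        · exact h1 e)
      (by
        rw [eq_univ_iff_forall]
        intro y
        rw [mem_iUnion]
        by_cases hy : s y ≤ d + 1
        · obtain ⟨e, he, hye⟩ := hb y (by exact_mod_cast hy)
          exact ⟨some ⟨e, he⟩, hye⟩
        · exact ⟨none, Or.inr (not_le.1 hy)⟩)
    let W' : ℕ → Set Y := fun e => {y | ∃ h : e < b, y ∈ W (some ⟨e, h⟩)}
    have hW'U : ∀ e, W' e ⊆ U e := by
      rintro e y ⟨h, hy⟩
      exact hWs _ hy
    have hW'o : ∀ e, IsOpen (W' e) := by
      intro e
      by_cases h : e < b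
      · have : W' e = W (some ⟨e, h⟩) := by
          ext y; exact ⟨fun ⟨_, hy⟩ => hy, fun hy => ⟨h, hy⟩⟩
        rw [this]; exact hWo _
      · have : W' e = ∅ := by
          ext y; exact ⟨fun ⟨h', hy⟩ => h h', fun hy => hy.elim⟩
        rw [this]; exact isOpen_empty
    have hord : ∀ y, {e | y ∈ W' e}.encard ≤ (m + 1 : ℕ) := by
      intro y
      have hsub : {e | y ∈ W' e} ⊆ (fun i : Option (Fin b) => i.elim 0 (fun e => (e : ℕ))) ''
          {i | y ∈ W i} := by
        rintro e ⟨h, hy⟩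
        exact ⟨some ⟨e, h⟩, hy, rfl⟩
      refine (encard_le_encard hsub).trans ((encard_image_le _ _).trans ?_)
      rw [← (toFinite {i | y ∈ W i}).cast_ncard_eq]
      have := hW y
      exact_mod_cast this
    refine ⟨fun e => (U e ∩ {y | s y < d}) ∪ W' e ∪ (U e ∩ {y | d + 1 < s y}), ⟨?_, ?_, ?_, ?_⟩, ?_⟩
    · intro e
      exact (((h1 e).inter (isOpen_lt hs continuous_const)).union (hW'o e)).union
        ((h1 e).inter (isOpen_lt continuous_const hs))
    · rintro e y ((⟨h, -⟩ | h) | ⟨h, -⟩)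
      · exact h2 e h
      · exact h2 e (hW'U e h)
      · exact h2 e h
    · intro d'
      obtain ⟨b', hb'⟩ := h3 d'
      refine ⟨max b b', fun y hy => ?_⟩
      by_cases hy1 : s y < d ∨ d + 1 < s y
      · obtain ⟨e, he, hye⟩ := hb' y hy
        refine ⟨e, lt_of_lt_of_le he (le_max_right _ _), ?_⟩
        rcases hy1 with h | h
        · exact Or.inl (Or.inl ⟨hye, h⟩)
        · exact Or.inr ⟨hye, h⟩
      · have : y ∈ ⋃ i, W i := by rw [hWc]; trivial
        obtain ⟨i, hi⟩ := mem_iUnion.1 this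
        rcases i with _ | e
        · exact absurd (hWs _ hi) hy1
        · exact ⟨e, lt_of_lt_of_le e.2 (le_max_left _ _), Or.inl (Or.inr ⟨e.2, hi⟩)⟩
    · intro y hy
      by_cases hyd : s y < d
      · refine (encard_le_encard ?_).trans (h4 y hyd)
        rintro e ((⟨h, -⟩ | h) | ⟨h, -⟩)
        · exact h
        · exact hW'U e h
        · exact h
      · refine (encard_le_encard ?_).trans (hord y)
        push_cast at hy
        rintro e ((⟨-, h⟩ | h) | ⟨-, h⟩)
        · exact absurd h hyd
        · exact h
        · exact absurd h (not_lt.2 hy.le)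
    · intro e y hy
      constructor
      · rintro ((⟨h, -⟩ | h) | ⟨h, -⟩)
        · exact h
        · exact hW'U e h
        · exact h
      · intro h
        exact Or.inl (Or.inl ⟨h, hy⟩)
  choose! F hF using step
  have h0 : Inv 0 O := ⟨hO, fun _ => subset_rfl, fun d' => ⟨d' + 1, fun y hy => hsO y d' hy⟩,
    fun y hy => absurd (hs0 y) (by simpa using hy)⟩
  let seq : ℕ → ℕ → Set Y := fun d => Nat.rec O (fun d U => F d U) d
  have hseq : ∀ d, Inv d (seq d) := by
    intro d
    induction d with
    | zero => exact h0
    | succ d ih => exact (hF d _ ih).1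
  have hst : ∀ (d k e : ℕ) y, s y < d → (y ∈ seq (d + k) e ↔ y ∈ seq d e) := by
    intro d k e y hy
    induction k with
    | zero => rfl
    | succ k ih =>
      rw [← ih]
      refine (hF (d + k) _ (hseq _)).2 e y (lt_of_lt_of_le hy ?_)
      push_cast
      linarith [(Nat.cast_nonneg k : (0:ℝ) ≤ k)]
  have hst' : ∀ (d d' e : ℕ) y, s y < d → s y < d' → (y ∈ seq d e ↔ y ∈ seq d' e) := by
    intro d d' e y h h'
    rw [← hst d d' e y h, ← hst d' d e y h', add_comm]
  refine ⟨fun e => ⋃ d : ℕ, {y | s y < d} ∩ seq d e, ?_, ?_, ?_, ?_⟩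
  · intro e
    exact isOpen_iUnion fun d => (isOpen_lt hs continuous_const).inter ((hseq d).1 e)
  · intro e
    exact iUnion_subset fun d => inter_subset_right.trans ((hseq d).2.1 e)
  · rw [eq_univ_iff_forall]
    intro y
    obtain ⟨d, hd⟩ := exists_nat_gt (s y)
    obtain ⟨b, hb⟩ := (hseq d).2.2.1 d
    obtain ⟨e, -, he⟩ := hb y hd.le
    exact mem_iUnion.2 ⟨e, mem_iUnion.2 ⟨d, hd, he⟩⟩
  · intro y
    obtain ⟨d, hd⟩ := exists_nat_gt (s y)
    refine (encard_le_encard ?_).trans ((hseq d).2.2.2 y hd)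
    intro e he
    obtain ⟨d', hd', he'⟩ := mem_iUnion.1 he
    exact (hst' d d' e y hd hd').2 he'

theorem dowker {Y J : Type*} [TopologicalSpace Y] [NormalSpace Y] [ParacompactSpace Y]
    (m : ℕ) (hdim : CovDimLE Y m)
    (V : J → Set Y) (hV : ∀ d, IsOpen (V d)) (hcov : ⋃ d, V d = univ) :
    ∃ V' : J → Set Y, (∀ d, IsOpen (V' d)) ∧ (∀ d, V' d ⊆ V d) ∧ (⋃ d, V' d = univ) ∧
      ∀ y, {d | y ∈ V' d}.encard ≤ (m + 1 : ℕ) := by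
  classical
  obtain ⟨ρ, hρ⟩ := PartitionOfUnity.exists_isSubordinate (isClosed_univ (X := Y)) V hV hcov.ge
  let O : Finset J → Set Y := fun σ => {y | ∀ i ∈ σ, 0 < ρ i y ∧ ∀ j, j ∉ σ → ρ j y < ρ i y}
  have hOo : ∀ σ, IsOpen (O σ) := by
    intro σ
    rw [isOpen_iff_mem_nhds]
    intro y0 hy0
    have h1 : ∀ᶠ y in 𝓝 y0, ∀ i ∈ σ, 0 < ρ i y :=
      (Filter.eventually_all_finset σ).2 fun i hi =>
        (ρ i).continuous.continuousAt.eventually (lt_mem_nhds (hy0 i hi).1)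
    have h2 : ∀ᶠ y in 𝓝 y0, ∀ i ∈ σ, ∀ j ∈ ρ.fintsupport y0, j ∉ σ → ρ j y < ρ i y := by
      refine (Filter.eventually_all_finset σ).2 fun i hi =>
        (Filter.eventually_all_finset _).2 fun j hj => ?_
      by_cases hjσ : j ∈ σ
      · exact Filter.Eventually.of_forall fun y h => absurd hjσ h
      · have := (ρ j).continuous.continuousAt.eventually_lt (ρ i).continuous.continuousAt
          ((hy0 i hi).2 j hjσ)
        filter_upwards [this] with y hy _ using hy
    filter_upwards [h1, h2, ρ.eventually_finsupport_subset y0] with y a1 a2 a3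
    intro i hi
    refine ⟨a1 i hi, fun j hj => ?_⟩
    by_cases hjS : j ∈ ρ.fintsupport y0
    · exact a2 i hi j hjS hj
    · have : j ∉ ρ.finsupport y := fun h => hjS (a3 h)
      have h0 : ρ j y = 0 := by
        by_contra h
        exact this ((ρ.mem_finsupport y).2 h)
      rw [h0]; exact a1 i hi
  have hOdis : ∀ σ τ y, σ.card = τ.card → y ∈ O σ → y ∈ O τ → σ = τ := by
    intro σ τ y hc hσ hτ
    by_contra hne
    have h1 : ¬ σ ⊆ τ := fun h => hne (Finset.eq_of_subset_of_card_le h hc.ge)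
    have h2 : ¬ τ ⊆ σ := fun h => hne (Finset.eq_of_subset_of_card_le h hc.le).symm
    obtain ⟨i, hi, hi'⟩ := Finset.not_subset.1 h1
    obtain ⟨j, hj, hj'⟩ := Finset.not_subset.1 h2
    exact lt_asymm ((hσ i hi).2 j hj') ((hτ j hj).2 i hi')
  have hOcov : ∀ y, ∃ σ : Finset J, σ.Nonempty ∧ y ∈ O σ := by
    intro y
    obtain ⟨i1, hi1⟩ := ρ.exists_pos (mem_univ y)
    have hne : (ρ.finsupport y).Nonempty := ⟨i1, (ρ.mem_finsupport y).2 hi1.ne'⟩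
    obtain ⟨i0, hi0, hmax⟩ := (ρ.finsupport y).exists_max_image (fun i => ρ i y) hne
    have hpos : 0 < ρ i0 y := lt_of_lt_of_le hi1 (hmax i1 ((ρ.mem_finsupport y).2 hi1.ne'))
    refine ⟨(ρ.finsupport y).filter (fun j => ρ i0 y ≤ ρ j y), ⟨i0, by simp [hi0]⟩, ?_⟩
    intro i hi
    rw [Finset.mem_filter] at hi
    refine ⟨hpos.trans_le hi.2, fun j hj => ?_⟩
    refine lt_of_lt_of_le ?_ hi.2
    by_cases hj' : j ∈ ρ.finsupport y
    · simpa [hj'] using hj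
    · have h0 : ρ j y = 0 := by
        by_contra h
        exact hj' ((ρ.mem_finsupport y).2 h)
      rwa [h0]
  obtain ⟨G, hGo, hGs, hGc, hG⟩ := dowker_countable m hdim
    (fun d => ⋃ σ : {σ : Finset J // σ.Nonempty ∧ σ.card = d}, O σ.1)
    (fun d => isOpen_iUnion fun σ => hOo _)
    (by
      rw [eq_univ_iff_forall]
      intro y
      obtain ⟨σ, h1, h2⟩ := hOcov y
      exact mem_iUnion.2 ⟨σ.card, mem_iUnion.2 ⟨⟨σ, h1, rfl⟩, h2⟩⟩)
  let jj : {σ : Finset J // σ.Nonempty} → J := fun σ => σ.2.choose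
  have hjj : ∀ σ : {σ : Finset J // σ.Nonempty}, jj σ ∈ σ.1 := fun σ => σ.2.choose_spec
  refine ⟨fun j => ⋃ σ : {σ : {σ : Finset J // σ.Nonempty} // jj σ = j}, O σ.1.1 ∩ G σ.1.1.card,
    ?_, ?_, ?_, ?_⟩
  · exact fun j => isOpen_iUnion fun σ => (hOo _).inter (hGo _)
  · intro j
    refine iUnion_subset ?_
    rintro ⟨σ, rfl⟩ y ⟨hy, -⟩
    exact hρ _ (subset_tsupport _ (ne_of_gt (hy _ (hjj σ)).1))
  · rw [eq_univ_iff_forall]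
    intro y
    have : y ∈ ⋃ d, G d := by rw [hGc]; trivial
    obtain ⟨d, hd⟩ := mem_iUnion.1 this
    obtain ⟨σ, hσ⟩ := mem_iUnion.1 (hGs d hd)
    refine mem_iUnion.2 ⟨jj ⟨σ.1, σ.2.1⟩, mem_iUnion.2 ⟨⟨⟨σ.1, σ.2.1⟩, rfl⟩, hσ, ?_⟩⟩
    simp only [σ.2.2]
    exact hd
  · intro y
    have : ∀ d, ∃ j : J, ∀ σ : {σ : Finset J // σ.Nonempty}, y ∈ O σ.1 → σ.1.card = d →
        jj σ = j := by
      intro d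
      by_cases h : ∃ σ : {σ : Finset J // σ.Nonempty}, y ∈ O σ.1 ∧ σ.1.card = d
      · obtain ⟨σ, h1, h2⟩ := h
        refine ⟨jj σ, fun τ h3 h4 => ?_⟩
        congr 1
        exact Subtype.ext (hOdis _ _ y (h4.trans h2.symm) h3 h1)
      · push Not at h
        obtain ⟨i1, hi1⟩ := ρ.exists_pos (mem_univ y)
        exact ⟨i1, fun σ h1 h2 => absurd h2 (h σ h1)⟩
    choose g hg using this
    refine (encard_le_encard (t := g '' {d | y ∈ G d}) ?_).trans ((encard_image_le _ _).trans (hG y))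
    intro j hj
    obtain ⟨⟨σ, rfl⟩, h1, h2⟩ := mem_iUnion.1 hj
    exact ⟨_, h2, (hg _ σ h1 rfl).symm⟩

/-- Fibrewise separation of the pairs outside `N`. -/
def GoodAt {X Y E : Type*} (f : X → Y) (N : Set (X × X)) (h : X → E) (y : Y) : Prop :=
  ∀ x x', f x = y → f x' = y → h x = h x' → (x, x') ∈ N

theorem good_open {X Y E T : Type*} [TopologicalSpace X] [TopologicalSpace Y] [TopologicalSpace E]
    [TopologicalSpace T] [CompactSpace T] [T2Space E] {f : X → Y} (hf : IsProperMap f)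
    {N : Set (X × X)} (hN : IsOpen N) (Q : T → X → E) (hQ : Continuous (fun q : T × X => Q q.1 q.2))
    (y0 : Y) (h : ∀ t, GoodAt f N (Q t) y0) :
    ∀ᶠ y in 𝓝 y0, ∀ t, GoodAt f N (Q t) y := by
  have hp : IsProperMap (Prod.map f f ∘ (Prod.snd : T × (X × X) → X × X)) :=
    (hf.prodMap hf).comp isProperMap_snd_of_compactSpace
  set B : Set (T × (X × X)) := {q | Q q.1 q.2.1 = Q q.1 q.2.2 ∧ q.2 ∉ N} with hB
  have hBc : IsClosed B := by
    refine IsClosed.inter ?_ ?_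
    · exact isClosed_eq (hQ.comp (by fun_prop : Continuous fun q : T × (X × X) => (q.1, q.2.1)))
        (hQ.comp (by fun_prop : Continuous fun q : T × (X × X) => (q.1, q.2.2)))
    · exact (hN.isClosed_compl).preimage continuous_snd
  have hc := hp.isClosedMap _ hBc
  have hy0 : (y0, y0) ∉ (Prod.map f f ∘ (Prod.snd : T × (X × X) → X × X)) '' B := by
    rintro ⟨⟨t, x, x'⟩, ⟨h1, h2⟩, h3⟩
    simp only [Function.comp, Prod.map, Prod.mk.injEq] at h3
    exact h2 (h t x x' h3.1 h3.2 h1)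
  have hcont : Continuous (fun y : Y => (y, y)) := by fun_prop
  filter_upwards [hcont.continuousAt.eventually (hc.isOpen_compl.mem_nhds hy0)] with y hy t x x' hx hx' hxx
  by_contra hn
  exact hy ⟨(t, x, x'), ⟨hxx, hn⟩, by simp [hx, hx']⟩

theorem lt_open {X Y T : Type*} [TopologicalSpace X] [TopologicalSpace Y]
    [TopologicalSpace T] [CompactSpace T] {f : X → Y} (hf : IsProperMap f)
    (w : T → X → ℝ) (hw : Continuous (fun q : T × X => w q.1 q.2)) (τ : X → ℝ) (hτ : Continuous τ)
    (y0 : Y) (h : ∀ t x, f x = y0 → w t x < τ x) :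
    ∀ᶠ y in 𝓝 y0, ∀ t x, f x = y → w t x < τ x := by
  have hp : IsProperMap (f ∘ (Prod.snd : T × X → X)) := hf.comp isProperMap_snd_of_compactSpace
  set B : Set (T × X) := {q | τ q.2 ≤ w q.1 q.2} with hB
  have hBc : IsClosed B := isClosed_le (by fun_prop) hw
  have hc := hp.isClosedMap _ hBc
  have hy0 : y0 ∉ (f ∘ (Prod.snd : T × X → X)) '' B := by
    rintro ⟨⟨t, x⟩, h1, h3⟩
    exact absurd (h t x h3) (not_lt.2 h1)
  filter_upwards [hc.isOpen_compl.mem_nhds hy0] with y hy t x hx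
  by_contra hn
  exact hy ⟨(t, x), not_lt.1 hn, hx⟩

theorem exists_partition {X : Type*} [TopologicalSpace X] [T2Space X] [NormalSpace X]
    (K : Set X) (hK : IsCompact K) (n : ℕ) (hdim : CovDimLE ↥K n) (O : X → Set X)
    (hO : ∀ x, IsOpen (O x)) (hxO : ∀ x ∈ K, x ∈ O x) :
    ∃ (L : ℕ) (p : Fin L → X → ℝ) (c : Fin L → X), (∀ l, Continuous (p l)) ∧
      (∀ l, c l ∈ K) ∧ (∀ x ∈ K, ∀ l, 0 ≤ p l x) ∧ (∀ x ∈ K, ∑ l, p l x = 1) ∧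
      (∀ x ∈ K, {l | p l x ≠ 0}.ncard ≤ n + 1) ∧ (∀ x ∈ K, ∀ l, p l x ≠ 0 → x ∈ O (c l)) := by
  have : CompactSpace ↥K := isCompact_iff_compactSpace.1 hK
  obtain ⟨t, htK, hcov⟩ := hK.elim_nhds_subcover O (fun x hx => (hO x).mem_nhds (hxO x hx))
  let c : Fin t.card → X := fun l => (t.equivFin.symm l : X)
  have hc : ∀ l, c l ∈ K := fun l => htK _ (t.equivFin.symm l).2
  obtain ⟨V, hVo, hVs, hVc, hV⟩ := hdim (Fin t.card) (fun l => Subtype.val ⁻¹' O (c l)) inferInstance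
    (fun l => (hO _).preimage continuous_subtype_val)
    (by
      rw [eq_univ_iff_forall]
      rintro ⟨x, hx⟩
      obtain ⟨z, hz, hxz⟩ := mem_iUnion₂.1 (hcov hx)
      exact mem_iUnion.2 ⟨t.equivFin ⟨z, hz⟩, by simpa [c] using hxz⟩)
  obtain ⟨ρ, hρ⟩ := PartitionOfUnity.exists_isSubordinate (isClosed_univ (X := ↥K)) V hVo hVc.ge
  have hext : ∀ l, ∃ g : C(X, ℝ), g.restrict K = ρ l := fun l =>
    ContinuousMap.exists_restrict_eq hK.isClosed (ρ l)
  choose g hg using hext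
  have hgρ : ∀ l x (hx : x ∈ K), g l x = ρ l ⟨x, hx⟩ := by
    intro l x hx
    rw [← hg l]; rfl
  have hmem : ∀ x (hx : x ∈ K) l, g l x ≠ 0 → (⟨x, hx⟩ : ↥K) ∈ V l := by
    intro x hx l h
    rw [hgρ l x hx] at h
    exact hρ l (subset_tsupport _ h)
  refine ⟨t.card, fun l => g l, c, fun l => (g l).continuous, hc, ?_, ?_, ?_, ?_⟩
  · intro x hx l
    show 0 ≤ g l x
    rw [hgρ l x hx]
    exact ρ.nonneg _ _
  · intro x hx
    rw [← ρ.sum_eq_one (mem_univ ⟨x, hx⟩), finsum_eq_sum_of_fintype]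
    exact Finset.sum_congr rfl fun l _ => hgρ l x hx
  · intro x hx
    have h1 := hV ⟨x, hx⟩
    have h2 : {l | g l x ≠ 0}.ncard ≤ {l | (⟨x, hx⟩ : ↥K) ∈ V l}.ncard :=
      ncard_le_ncard (fun l hl => hmem x hx l hl) (toFinite _)
    have h3 : {l | (⟨x, hx⟩ : ↥K) ∈ V l}.ncard ≤ n + 1 := by exact_mod_cast h1
    exact h2.trans h3
  · intro x hx l h
    exact hVs l (hmem x hx l h)

theorem core_step {X Y E : Type*} [TopologicalSpace X] [TopologicalSpace Y] [T2Space X]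
    [NormalSpace X] [NormedAddCommGroup E] [NormedSpace ℝ E] [FiniteDimensional ℝ E]
    {f : X → Y} (hf : IsProperMap f) {N : Set (X × X)} (hN : IsOpen N) (hNd : ∀ x, (x, x) ∈ N)
    (n r : ℕ) (hr : r + 2 * n < Module.finrank ℝ E)
    (y0 : Y) (hdim : CovDimLE ↥(f ⁻¹' {y0}) n)
    (U : (Fin (r + 1) → ℝ) → X → E) (hU : Continuous (fun q : (Fin (r + 1) → ℝ) × X => U q.1 q.2))
    (hbd : ∀ s ∈ stdSimplex ℝ (Fin (r + 1)), (∃ a, s a = 0) → GoodAt f N (U s) y0)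
    (τ : X → ℝ) (hτ : Continuous τ) (hτ0 : ∀ x, 0 < τ x) (hK : IsCompact (f ⁻¹' {y0})) :
    ∃ (w : (Fin (r + 1) → ℝ) → X → E) (W : Set Y), IsOpen W ∧ y0 ∈ W ∧
      Continuous (fun q : (Fin (r + 1) → ℝ) × X => w q.1 q.2) ∧
      (∀ s, (∃ a, s a = 0) → ∀ x, w s x = 0) ∧
      ∀ y ∈ W, ∀ s ∈ stdSimplex ℝ (Fin (r + 1)), GoodAt f N (fun x => U s x + w s x) y ∧
        ∀ x, f x = y → ‖w s x‖ ≤ τ x := by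
  set K := f ⁻¹' {y0} with hKdef
  set Δ := stdSimplex ℝ (Fin (r + 1)) with hΔdef
  have hΔ : IsCompact Δ := isCompact_stdSimplex ℝ _
  have hΔT : CompactSpace ↥Δ := isCompact_iff_compactSpace.1 hΔ
  let μ : (Fin (r + 1) → ℝ) → ℝ := fun s => ∏ a, s a
  have hμ : Continuous μ := by fun_prop
  have hμ0 : ∀ s ∈ Δ, 0 ≤ μ s := fun s hs => Finset.prod_nonneg fun a _ => hs.1 a
  -- tolerance from τ
  obtain ⟨η1, hη1, hη1τ⟩ := hK.exists_forall_le' hτ.continuousOn (a := 0) (fun x _ => hτ0 x)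
  -- tolerance from the boundary
  have hBc : IsCompact ((Δ ×ˢ (K ×ˢ K)) ∩ {q : (Fin (r + 1) → ℝ) × (X × X) | q.2 ∉ N}) :=
    (hΔ.prod (hK.prod hK)).inter_right (hN.isClosed_compl.preimage continuous_snd)
  have hUc1 : Continuous (fun q : (Fin (r + 1) → ℝ) × (X × X) => U q.1 q.2.1) :=
    hU.comp (by fun_prop : Continuous fun q : (Fin (r + 1) → ℝ) × (X × X) => (q.1, q.2.1))
  have hUc2 : Continuous (fun q : (Fin (r + 1) → ℝ) × (X × X) => U q.1 q.2.2) :=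
    hU.comp (by fun_prop : Continuous fun q : (Fin (r + 1) → ℝ) × (X × X) => (q.1, q.2.2))
  obtain ⟨c, hc, hcB⟩ := hBc.exists_forall_le'
    (f := fun q : (Fin (r + 1) → ℝ) × (X × X) => μ q.1 + ‖U q.1 q.2.1 - U q.1 q.2.2‖)
    (by fun_prop) (a := 0) (by
      rintro ⟨s, x, x'⟩ ⟨⟨hs, hx, hx'⟩, hn⟩
      simp only at hs hx hx' hn ⊢
      by_cases h0 : μ s = 0
      · obtain ⟨a, -, ha⟩ := Finset.prod_eq_zero_iff.1 h0
        have hne : U s x ≠ U s x' := fun he => hn (hbd s hs ⟨a, ha⟩ x x' hx hx' he)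
        have := norm_pos_iff.2 (sub_ne_zero.2 hne)
        linarith
      · have := lt_of_le_of_ne (hμ0 s hs) (Ne.symm h0)
        have := norm_nonneg (U s x - U s x')
        linarith)
  set η := min (η1 / 2) (c / 8) with hηdef
  have hη : 0 < η := lt_min (by linarith) (by linarith)
  have hηa : η ≤ η1 / 2 := min_le_left _ _
  have hηb : η ≤ c / 8 := min_le_right _ _
  -- the small neighbourhoods
  have hosc : ∀ x0, ∃ O : Set X, IsOpen O ∧ x0 ∈ O ∧ O ×ˢ O ⊆ N ∧
      ∀ x ∈ O, ∀ s ∈ Δ, ‖U s x - U s x0‖ < η / 4 := by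
    intro x0
    obtain ⟨A, B, hA, hB, hxA, hxB, hAB⟩ := isOpen_prod_iff.1 hN x0 x0 (hNd x0)
    have hev : ∀ᶠ x in 𝓝 x0, ∀ s ∈ Δ, ‖U s x - U s x0‖ < η / 4 := by
      refine hΔ.eventually_forall_of_forall_eventually fun s hs => ?_
      have hcont : Continuous (fun q : X × (Fin (r + 1) → ℝ) => ‖U q.2 q.1 - U q.2 x0‖) := by
        have h1 : Continuous (fun q : X × (Fin (r + 1) → ℝ) => U q.2 q.1) :=
          hU.comp (by fun_prop : Continuous fun q : X × (Fin (r + 1) → ℝ) => (q.2, q.1))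
        have h2 : Continuous (fun q : X × (Fin (r + 1) → ℝ) => U q.2 x0) :=
          hU.comp (by fun_prop : Continuous fun q : X × (Fin (r + 1) → ℝ) => (q.2, x0))
        fun_prop
      refine hcont.continuousAt.eventually (gt_mem_nhds ?_)
      simp only [sub_self, norm_zero]; linarith
    obtain ⟨O, hO1, hO2, hO3⟩ := eventually_nhds_iff.1 hev
    refine ⟨O ∩ A ∩ B, (hO2.inter hA).inter hB, ⟨⟨hO3, hxA⟩, hxB⟩, ?_, fun x hx => hO1 x hx.1.1⟩
    rintro ⟨x, x'⟩ ⟨hx, hx'⟩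
    exact hAB ⟨hx.1.2, hx'.2⟩
  choose O hOo hxO hON hOU using hosc
  obtain ⟨L, p, cc, hp, hccK, hp0, hp1, hpn, hpO⟩ := exists_partition K hK n hdim O hOo
    (fun x _ => hxO x)
  -- smooth approximations
  have hbex : ∀ l, ∃ b : (Fin (r + 1) → ℝ) → E, ContDiff ℝ 1 b ∧
      ∀ s, ‖b s - U s (cc l)‖ < η / 4 := by
    intro l
    have hcont : Continuous (fun s => U s (cc l)) :=
      hU.comp (by fun_prop : Continuous fun s : (Fin (r + 1) → ℝ) => (s, cc l))
    obtain ⟨b, hb1, hb2, -⟩ := hcont.exists_contDiff_approx 1 (ε := fun _ => η / 4)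
      continuous_const (fun _ => by linarith)
    refine ⟨b, by exact_mod_cast hb1, fun s => ?_⟩
    rw [← dist_eq_norm]; exact hb2 s
  choose b hb hbU using hbex
  -- generic choice
  let θ : (Fin r → ℝ) → (Fin (r + 1) → ℝ) := fun t => Fin.cons (1 - ∑ i, t i) t
  have hθ : ContDiff ℝ 1 θ := by
    rw [contDiff_pi]
    intro i
    refine Fin.cases ?_ (fun j => ?_) i
    · simp only [θ, Fin.cons_zero]; fun_prop
    · simp only [θ, Fin.cons_succ]; fun_prop
  have hθs : ∀ s ∈ Δ, θ (Fin.tail s) = s := by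
    intro s hs
    have h1 := hs.2
    rw [Fin.sum_univ_succ] at h1
    have h2 : 1 - ∑ i, Fin.tail s i = s 0 := by
      simp only [Fin.tail]; linarith
    simp only [θ, h2, Fin.cons_self_tail]
  have hdense := generic_dense n (fun l t => b l (θ t)) (fun l => (hb l).comp hθ)
    (by simpa using hr)
  obtain ⟨a, haball, hagen⟩ := hdense.exists_mem_open (Metric.isOpen_ball (x := (0 : Fin L → E))
    (ε := η / 4)) ⟨0, by simp [hη]⟩
  have ha : ∀ l, ‖a l‖ < η / 4 := by
    intro l
    exact lt_of_le_of_lt (norm_le_pi_norm a l) (by simpa using hagen)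
  let D : (Fin (r + 1) → ℝ) → X → E := fun s x => ∑ l, p l x • (b l s + a l)
  have hD : Continuous (fun q : (Fin (r + 1) → ℝ) × X => D q.1 q.2) := by
    have hb' : ∀ l, Continuous (b l) := fun l => (hb l).continuous
    fun_prop
  have hDU : ∀ s ∈ Δ, ∀ x ∈ K, ‖D s x - U s x‖ ≤ η := by
    intro s hs x hx
    have e1 : D s x - U s x = ∑ l, p l x • (b l s + a l - U s x) := by
      simp only [D, smul_sub, Finset.sum_sub_distrib, ← Finset.sum_smul, hp1 x hx, one_smul]
    rw [e1]
    calc ‖∑ l, p l x • (b l s + a l - U s x)‖ ≤ ∑ l, p l x * η := by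
          refine norm_sum_le_of_le _ fun l _ => ?_
          rw [norm_smul, Real.norm_of_nonneg (hp0 x hx l)]
          by_cases h0 : p l x = 0
          · simp [h0]
          · refine mul_le_mul_of_nonneg_left ?_ (hp0 x hx l)
            have h1 := hOU _ x (hpO x hx l h0) s hs
            have h2 := hbU l s
            have h3 := ha l
            have e2 : b l s + a l - U s x = (b l s - U s (cc l)) + a l - (U s x - U s (cc l)) := by
              abel
            rw [e2]
            refine (norm_sub_le _ _).trans ?_
            have := norm_add_le (b l s - U s (cc l)) (a l)
            linarith
      _ = η := by rw [← Finset.sum_mul, hp1 x hx, one_mul]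
  have hDgood : ∀ s ∈ Δ, GoodAt f N (D s) y0 := by
    intro s hs x x' hx hx' he
    by_contra hn
    have hxK : x ∈ K := hx
    have hxK' : x' ∈ K := hx'
    refine haball (Fin.tail s) (fun l => p l x - p l x') ?_ ?_ ?_ ?_
    · rw [Finset.sum_sub_distrib, hp1 x hxK, hp1 x' hxK', sub_self]
    · have hsub : {l | p l x - p l x' ≠ 0} ⊆ {l | p l x ≠ 0} ∪ {l | p l x' ≠ 0} := by
        intro l hl
        by_contra hcon
        have h1 : ¬ (p l x ≠ 0) := fun h => hcon (Or.inl h)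
        have h2 : ¬ (p l x' ≠ 0) := fun h => hcon (Or.inr h)
        push Not at h1 h2
        exact hl (by rw [h1, h2, sub_self])
      have h1 := ncard_le_ncard hsub (toFinite _)
      have h2 := ncard_union_le {l | p l x ≠ 0} {l | p l x' ≠ 0}
      have h3 := hpn x hxK
      have h4 := hpn x' hxK'
      omega
    · intro h0
      obtain ⟨l, hl⟩ : ∃ l, p l x ≠ 0 := by
        by_contra! hall
        have := hp1 x hxK
        simp [hall] at this
      have h1 : p l x - p l x' = 0 := congrFun h0 l
      have h2 : p l x' ≠ 0 := by
        intro h; rw [h, sub_zero] at h1; exact hl h1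
      exact hn (hON _ ⟨hpO x hxK l hl, hpO x' hxK' l h2⟩)
    · rw [hθs s hs]
      simp only [sub_smul, Finset.sum_sub_distrib]
      exact sub_eq_zero.2 he
  let χ : (Fin (r + 1) → ℝ) → ℝ := fun s => min 1 (|μ s| / (c / 2))
  have hχ : Continuous χ := by
    refine continuous_const.min ?_
    exact (hμ.abs).div_const _
  have hχ0 : ∀ s, 0 ≤ χ s := fun s => le_min zero_le_one (by positivity)
  have hχ1 : ∀ s, χ s ≤ 1 := fun s => min_le_left _ _
  let w : (Fin (r + 1) → ℝ) → X → E := fun s x => χ s • (D s x - U s x)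
  have hw : Continuous (fun q : (Fin (r + 1) → ℝ) × X => w q.1 q.2) := by fun_prop
  have hwη : ∀ s ∈ Δ, ∀ x ∈ K, ‖w s x‖ ≤ η := by
    intro s hs x hx
    simp only [w]
    rw [norm_smul, Real.norm_of_nonneg (hχ0 s)]
    have := hDU s hs x hx
    nlinarith [hχ0 s, hχ1 s, norm_nonneg (D s x - U s x)]
  have hgood0 : ∀ s ∈ Δ, GoodAt f N (fun x => U s x + w s x) y0 := by
    intro s hs
    by_cases hcase : c / 2 ≤ μ s
    · have h1 : χ s = 1 := by
        refine min_eq_left ?_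
        rw [le_div_iff₀ (by linarith), abs_of_nonneg (hμ0 s hs)]; linarith
      have : (fun x => U s x + w s x) = D s := by
        ext x; simp [w, h1]
      rw [this]; exact hDgood s hs
    · push Not at hcase
      intro x x' hx hx' he
      by_contra hn
      have h1 := hcB (s, x, x') ⟨⟨hs, hx, hx'⟩, hn⟩
      simp only at h1 he
      have h2 := hwη s hs x hx
      have h3 := hwη s hs x' hx'
      have e : U s x - U s x' = w s x' - w s x := by
        have : U s x = U s x' + w s x' - w s x := by rw [← he]; abel
        rw [this]; abel
      rw [e] at h1
      have := norm_sub_le (w s x') (w s x)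
      linarith
  have hev1 := good_open (T := ↥Δ) hf hN (fun s x => U s.1 x + w s.1 x)
    (by
      have h1 : Continuous (fun q : ↥Δ × X => U q.1.1 q.2) :=
        hU.comp (by fun_prop : Continuous fun q : ↥Δ × X => (q.1.1, q.2))
      have h2 : Continuous (fun q : ↥Δ × X => w q.1.1 q.2) :=
        hw.comp (by fun_prop : Continuous fun q : ↥Δ × X => (q.1.1, q.2))
      exact h1.add h2) y0 (fun s => hgood0 s.1 s.2)
  have hev2 := lt_open (T := ↥Δ) hf (fun s x => ‖w s.1 x‖)
    (by
      have h2 : Continuous (fun q : ↥Δ × X => w q.1.1 q.2) :=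
        hw.comp (by fun_prop : Continuous fun q : ↥Δ × X => (q.1.1, q.2))
      exact h2.norm) τ hτ y0 (fun s x hx => by
        have h1 := hwη s.1 s.2 x hx
        have h2 := hη1τ x hx
        linarith)
  obtain ⟨W, hW1, hW2, hW3⟩ := eventually_nhds_iff.1 (hev1.and hev2)
  refine ⟨w, W, hW2, hW3, hw, ?_, ?_⟩
  · rintro s ⟨a, ha⟩ x
    have : μ s = 0 := Finset.prod_eq_zero (Finset.mem_univ a) ha
    simp [w, χ, this]
  · intro y hy s hs
    exact ⟨(hW1 y hy).1 ⟨s, hs⟩, fun x hx => ((hW1 y hy).2 ⟨s, hs⟩ x hx).le⟩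

/-- The point of the (infinite) simplex with coordinates `s a` at the vertices `e a`. -/
def push {Y : Type*} {r : ℕ} (e : Fin r → Y) (s : Fin r → ℝ) : Y →₀ ℝ :=
  ∑ a, Finsupp.single (e a) (s a)

theorem push_map {Y Z : Type*} {r : ℕ} (π : Y → Z) (e : Fin r → Y) (s : Fin r → ℝ) :
    Finsupp.mapDomain π (push e s) = push (π ∘ e) s := by
  simp [push, Finsupp.mapDomain_finsetSum, Finsupp.mapDomain_single]

theorem push_nonneg {Y : Type*} {r : ℕ} (e : Fin r → Y) (s : Fin r → ℝ) (hs : ∀ a, 0 ≤ s a)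
    (j : Y) : 0 ≤ push e s j := by
  classical
  simp only [push, Finsupp.finsetSum_apply, Finsupp.single_apply]
  refine Finset.sum_nonneg fun a _ => ?_
  split_ifs
  · exact hs a
  · exact le_rfl

theorem push_degree {Y : Type*} {r : ℕ} (e : Fin r → Y) (s : Fin r → ℝ) :
    (push e s).degree = ∑ a, s a := by
  simp [push]

theorem push_continuous {Y : Type*} {r : ℕ} (e : Fin r → Y) (j : Y) :
    Continuous fun s : Fin r → ℝ => push e s j := by
  classical
  simp only [push, Finsupp.finsetSum_apply, Finsupp.single_apply]
  refine continuous_finsetSum _ fun a _ => ?_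
  split_ifs
  · fun_prop
  · fun_prop

open Classical in
theorem push_support {Y : Type*} {r : ℕ} (e : Fin r → Y) (s : Fin r → ℝ) :
    (push e s).support ⊆ (Finset.univ.filter fun a => s a ≠ 0).image e := by
  intro j hj
  rw [Finsupp.mem_support_iff] at hj
  simp only [push, Finsupp.finsetSum_apply, Finsupp.single_apply] at hj
  obtain ⟨a, -, ha⟩ := Finset.exists_ne_zero_of_sum_ne_zero hj
  by_cases h : e a = j
  · simp only [h, if_true] at ha
    exact Finset.mem_image.2 ⟨a, by simp [ha], h⟩
  · simp [h] at ha

open Classical in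
theorem push_enum {Y : Type*} {r : ℕ} (e : Fin r → Y) (he : Function.Injective e) (t : Y →₀ ℝ)
    (ht : t.support ⊆ Finset.univ.image e) : push e (fun a => t (e a)) = t := by
  ext j
  simp only [push, Finsupp.finsetSum_apply, Finsupp.single_apply]
  by_cases hj : ∃ a, e a = j
  · obtain ⟨a, rfl⟩ := hj
    rw [Finset.sum_eq_single a]
    · simp
    · intro b _ hb
      simp [he.ne hb]
    · simp
  · have h0 : t j = 0 := by
      by_contra h
      obtain ⟨a, -, ha⟩ := Finset.mem_image.1 (ht (Finsupp.mem_support_iff.2 h))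
      exact hj ⟨a, ha⟩
    rw [h0]
    refine Finset.sum_eq_zero fun a _ => ?_
    rw [if_neg]
    exact fun h => hj ⟨a, h⟩

/-- Radial retraction to the ball of radius `ρ`. -/
def clampTo {E : Type*} [NormedAddCommGroup E] [NormedSpace ℝ E] (ρ : ℝ) (v : E) : E :=
  (ρ / max ρ ‖v‖) • v

theorem clampTo_le {E : Type*} [NormedAddCommGroup E] [NormedSpace ℝ E] {ρ : ℝ} (hρ : 0 < ρ)
    (v : E) : ‖clampTo ρ v‖ ≤ ρ := by
  have hm : 0 < max ρ ‖v‖ := lt_max_of_lt_left hρ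
  rw [clampTo, norm_smul, Real.norm_of_nonneg (by positivity), div_mul_eq_mul_div,
    div_le_iff₀ hm]
  exact mul_le_mul_of_nonneg_left (le_max_right _ _) hρ.le

theorem clampTo_eq {E : Type*} [NormedAddCommGroup E] [NormedSpace ℝ E] {ρ : ℝ} (hρ : 0 < ρ)
    {v : E} (h : ‖v‖ ≤ ρ) : clampTo ρ v = v := by
  rw [clampTo, max_eq_left h, div_self hρ.ne', one_smul]

structure Tower {X Y E : Type*} [TopologicalSpace X] [TopologicalSpace Y]
    [NormedAddCommGroup E] [NormedSpace ℝ E] (f : X → Y) (N : Set (X × X)) (g : X → E)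
    (β : X → ℝ) (i : ℕ) (V : Y → Set Y) (U : (Y →₀ ℝ) → X → E) : Prop where
  op : ∀ j, IsOpen (V j)
  lf : LocallyFinite V
  cov : ⋃ j, V j = univ
  cont : ∀ (r : ℕ) (e : Fin r → Y), Continuous fun q : (Fin r → ℝ) × X => U (push e q.1) q.2
  close : ∀ t x, ‖U t x - g x‖ ≤ β x
  good : ∀ (y : Y) (t : Y →₀ ℝ), (∀ j, 0 ≤ t j) → t.degree = 1 → t.support.card ≤ i →
    (∀ j ∈ t.support, y ∈ closure (V j)) → GoodAt f N (U t) y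

theorem degree_map {Y Z : Type*} (π : Y → Z) (t : Y →₀ ℝ) :
    (Finsupp.mapDomain π t).degree = t.degree := by
  induction t using Finsupp.induction_linear with
  | zero => simp
  | add a b ha hb => rw [Finsupp.mapDomain_add, map_add, map_add, ha, hb]
  | single a b => simp [Finsupp.mapDomain_single]

theorem map_nonneg_coe {Y Z : Type*} (π : Y → Z) (t : Y →₀ ℝ) (ht : ∀ j, 0 ≤ t j) (z : Z) :
    0 ≤ Finsupp.mapDomain π t z := by
  classical
  rw [Finsupp.mapDomain, Finsupp.sum_apply]
  refine Finset.sum_nonneg fun a _ => ?_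
  simp only [Finsupp.single_apply]
  split_ifs
  · exact ht a
  · exact le_rfl

theorem tower_step {X Y E : Type*} [TopologicalSpace X] [TopologicalSpace Y] [T2Space X] [T2Space Y]
    [NormalSpace X] [ParacompactSpace Y] [Nonempty Y]
    [NormedAddCommGroup E] [NormedSpace ℝ E] [FiniteDimensional ℝ E]
    {f : X → Y} (hf : IsProperMap f) {N : Set (X × X)} (hN : IsOpen N) (hNd : ∀ x, (x, x) ∈ N)
    (n i : ℕ) (hr : i + 2 * n < Module.finrank ℝ E)
    (hdim : ∀ y, CovDimLE ↥(f ⁻¹' {y}) n) (g : X → E) (hg : Continuous g)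
    (β γ : X → ℝ) (hβ : Continuous β) (hγ : Continuous γ) (hβ0 : ∀ x, 0 ≤ β x)
    (hγ0 : ∀ x, 0 < γ x) (V : Y → Set Y) (U : (Y →₀ ℝ) → X → E) (hT : Tower f N g β i V U) :
    ∃ V' U', Tower f N g (fun x => β x + γ x) (i + 1) V' U' := by
  classical
  have hK : ∀ y, IsCompact (f ⁻¹' {y}) := fun y => hf.isCompact_preimage isCompact_singleton
  have hcore : ∀ (y0 : Y) (e : Fin (i + 1) → Y),
      ∃ (w : (Fin (i + 1) → ℝ) → X → E) (W : Set Y), IsOpen W ∧ y0 ∈ W ∧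
      Continuous (fun q : (Fin (i + 1) → ℝ) × X => w q.1 q.2) ∧
      (∀ s, (∃ a, s a = 0) → ∀ x, w s x = 0) ∧
      ((∀ a, y0 ∈ closure (V (e a))) → ∀ y ∈ W, ∀ s ∈ stdSimplex ℝ (Fin (i + 1)),
        GoodAt f N (fun x => U (push e s) x + w s x) y ∧
        ∀ x, f x = y → ‖w s x‖ ≤ γ x) := by
    intro y0 e
    by_cases he : ∀ a, y0 ∈ closure (V (e a))
    · obtain ⟨w, W, h1, h2, h3, h4, h5⟩ := core_step hf hN hNd n i hr y0 (hdim y0)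
        (fun s => U (push e s)) (hT.cont _ e) (by
          rintro s hs ⟨a, ha⟩
          refine hT.good y0 _ (push_nonneg e s hs.1) ?_ ?_ ?_
          · rw [push_degree]; exact hs.2
          · refine (Finset.card_le_card (push_support e s)).trans (Finset.card_image_le.trans ?_)
            have : (Finset.univ.filter fun a => s a ≠ 0) ⊆ Finset.univ.erase a := by
              intro b hb
              simp only [Finset.mem_filter, Finset.mem_univ, true_and] at hb
              refine Finset.mem_erase.2 ⟨?_, Finset.mem_univ _⟩
              rintro rfl
              exact hb ha
            refine (Finset.card_le_card this).trans ?_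
            simp
          · intro j hj
            obtain ⟨b, -, rfl⟩ := Finset.mem_image.1 (push_support e s hj)
            exact he b) γ hγ hγ0 (hK y0)
      exact ⟨w, W, h1, h2, h3, h4, fun _ => h5⟩
    · exact ⟨fun _ _ => 0, univ, isOpen_univ, mem_univ _, continuous_const, fun _ _ _ => rfl,
        fun h => absurd h he⟩
  choose w W hWo hyW hw hw0 hwW using hcore
  have hπ : ∀ y, ∃ j, y ∈ V j := fun y => mem_iUnion.1 (hT.cov ▸ mem_univ y)
  choose π hπ using hπ
  let W0 : Y → Set Y := fun y0 => V (π y0) ∩ (⋃ j : {j // y0 ∉ closure (V j)}, closure (V j))ᶜ ∩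
    ⋂ e ∈ {e : Fin (i + 1) → Y | ∀ a, y0 ∈ closure (V (e a))}, W y0 e
  have hW0o : ∀ y0, IsOpen (W0 y0) := by
    intro y0
    refine ((hT.op _).inter ?_).inter ?_
    · rw [isOpen_compl_iff]
      exact (hT.lf.closure.comp_injective Subtype.val_injective).isClosed_iUnion
        fun _ => isClosed_closure
    · refine Set.Finite.isOpen_biInter ?_ fun e _ => hWo y0 e
      have := hT.lf.closure.point_finite y0
      exact Set.Finite.pi' (t := fun _ : Fin (i + 1) => {j | y0 ∈ closure (V j)}) fun _ => this
  have hyW0 : ∀ y0, y0 ∈ W0 y0 := by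
    intro y0
    refine ⟨⟨hπ y0, ?_⟩, ?_⟩
    · rintro h
      obtain ⟨j, hj⟩ := mem_iUnion.1 h
      exact j.2 hj
    · exact mem_iInter₂.2 fun e _ => hyW y0 e
  obtain ⟨v, hvo, hvc, hvl, hvW⟩ := precise_refinement W0 hW0o
    (eq_univ_iff_forall.2 fun y => mem_iUnion.2 ⟨y, hyW0 y⟩)
  obtain ⟨V', hV'c, hV'o, hV'v⟩ := exists_iUnion_eq_closure_subset hvo hvl.point_finite hvc
  have hV'W : ∀ j, closure (V' j) ⊆ W0 j := fun j => (hV'v j).trans (hvW j)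
  have hen : ∀ σ : Finset Y, ∃ e : Fin (i + 1) → Y, σ.card = i + 1 →
      Function.Injective e ∧ Finset.univ.image e = σ := by
    intro σ
    by_cases h : σ.card = i + 1
    · refine ⟨fun a => ((Finset.equivFinOfCardEq h).symm a : Y), fun _ => ⟨?_, ?_⟩⟩
      · exact Subtype.val_injective.comp (Equiv.injective _)
      · ext j
        simp only [Finset.mem_image, Finset.mem_univ, true_and]
        constructor
        · rintro ⟨a, rfl⟩
          exact Subtype.property _
        · intro hj
          exact ⟨Finset.equivFinOfCardEq h ⟨j, hj⟩, by simp⟩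
    · exact ⟨fun _ => Classical.arbitrary Y, fun h' => absurd h' h⟩
  choose en hen using hen
  let wσ : Finset Y → (Y →₀ ℝ) → X → E := fun σ t x =>
    w (en σ 0) (π ∘ en σ) (fun a => t (en σ a)) x
  have hwσ0 : ∀ (σ : Finset Y) (t : Y →₀ ℝ) (x : X), σ.card = i + 1 → (∃ j ∈ σ, t j = 0) →
      wσ σ t x = 0 := by
    rintro σ t x hσ ⟨j, hj, htj⟩
    rw [← (hen σ hσ).2] at hj
    obtain ⟨a, -, rfl⟩ := Finset.mem_image.1 hj
    exact hw0 _ _ _ ⟨a, htj⟩ x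
  let Z : (Y →₀ ℝ) → X → E := fun t x => U (Finsupp.mapDomain π t) x +
    ∑ σ ∈ t.support.powersetCard (i + 1), wσ σ t x
  let U' : (Y →₀ ℝ) → X → E := fun t x => g x + clampTo (β x + γ x) (Z t x - g x)
  have hpos : ∀ x, 0 < β x + γ x := fun x => add_pos_of_nonneg_of_pos (hβ0 x) (hγ0 x)
  refine ⟨V', U', hV'o, hvl.subset fun j => subset_closure.trans (hV'v j), hV'c, ?_, ?_, ?_⟩
  · intro r e
    have hZ : Continuous fun q : (Fin r → ℝ) × X => Z (push e q.1) q.2 := by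
      have hEq : (fun q : (Fin r → ℝ) × X => Z (push e q.1) q.2) =
          fun q => U (push (π ∘ e) q.1) q.2 +
            ∑ σ ∈ (Finset.univ.image e).powersetCard (i + 1), wσ σ (push e q.1) q.2 := by
        ext1 ⟨s, x⟩
        simp only [Z]
        rw [push_map]
        congr 1
        refine Finset.sum_subset (Finset.powersetCard_mono ((push_support e s).trans
          (Finset.image_subset_image (Finset.filter_subset _ _)))) ?_
        intro σ hσ hσ'
        rw [Finset.mem_powersetCard] at hσ hσ'
        refine hwσ0 σ _ x hσ.2 ?_
        by_contra! hcon
        exact hσ' ⟨fun j hj => Finsupp.mem_support_iff.2 (hcon j hj), hσ.2⟩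
      rw [hEq]
      refine (hT.cont r (π ∘ e)).add (continuous_finsetSum _ fun σ _ => ?_)
      have hin : Continuous fun q : (Fin r → ℝ) × X =>
          ((fun a => push e q.1 (en σ a), q.2) : (Fin (i + 1) → ℝ) × X) := by
        refine Continuous.prodMk (continuous_pi fun a => ?_) continuous_snd
        exact (push_continuous e (en σ a)).comp continuous_fst
      exact (hw (en σ 0) (π ∘ en σ)).comp hin
    have hZg : Continuous fun q : (Fin r → ℝ) × X => Z (push e q.1) q.2 - g q.2 :=
      hZ.sub (hg.comp continuous_snd)
    simp only [U', clampTo]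
    refine (hg.comp continuous_snd).add (Continuous.smul ?_ hZg)
    have hβγ : Continuous fun q : (Fin r → ℝ) × X => β q.2 + γ q.2 := by fun_prop
    refine Continuous.div hβγ (hβγ.max hZg.norm) fun q => ?_
    exact (lt_max_of_lt_left (hpos q.2)).ne'
  · intro t x
    simp only [U', add_sub_cancel_left]
    exact clampTo_le (hpos x) _
  · intro y t ht0 ht1 htc hty
    suffices hs : GoodAt f N (Z t) y ∧ ∀ x, f x = y → ‖Z t x - g x‖ ≤ β x + γ x by
      intro x x' hx hx' he
      refine hs.1 x x' hx hx' ?_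
      simp only [U'] at he
      rwa [clampTo_eq (hpos x) (hs.2 x hx), clampTo_eq (hpos x') (hs.2 x' hx'),
        add_sub_cancel, add_sub_cancel] at he
    have hyW0' : ∀ j ∈ t.support, y ∈ W0 j := fun j hj => hV'W j (hty j hj)
    rcases Nat.lt_or_ge i t.support.card with hlt | hge
    · have hcard : t.support.card = i + 1 := le_antisymm htc hlt
      obtain ⟨hinj, himg⟩ := hen _ hcard
      set e := en t.support with hedef
      set s : Fin (i + 1) → ℝ := fun a => t (e a) with hsdef
      have hpush : push e s = t := push_enum e hinj t himg.ge
      have hZt : Z t = fun x => U (push (π ∘ e) s) x + w (e 0) (π ∘ e) s x := by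
        ext1 x
        simp only [Z]
        have hps : t.support.powersetCard (i + 1) = {t.support} := by
          rw [← hcard, Finset.powersetCard_self]
        rw [hps, Finset.sum_singleton, ← push_map, hpush]
      have hmem : ∀ a, e a ∈ t.support := fun a => by
        rw [← himg]; exact Finset.mem_image_of_mem _ (Finset.mem_univ a)
      have hsΔ : s ∈ stdSimplex ℝ (Fin (i + 1)) := by
        refine ⟨fun a => ht0 _, ?_⟩
        rw [← push_degree e s, hpush, ht1]
      have hcl : ∀ a, e 0 ∈ closure (V ((π ∘ e) a)) := by
        intro a
        by_contra hcon
        refine (hyW0' _ (hmem 0)).1.2 (mem_iUnion.2 ⟨⟨_, hcon⟩, ?_⟩)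
        exact subset_closure (hyW0' _ (hmem a)).1.1
      have hyW' : y ∈ W (e 0) (π ∘ e) := mem_iInter₂.1 (hyW0' _ (hmem 0)).2 (π ∘ e) hcl
      obtain ⟨h1, h2⟩ := hwW (e 0) (π ∘ e) hcl y hyW' s hsΔ
      rw [hZt]
      refine ⟨h1, fun x hx => ?_⟩
      have h3 := h2 x hx
      have h4 := hT.close (push (π ∘ e) s) x
      rw [add_sub_right_comm]
      exact (norm_add_le _ _).trans (add_le_add h4 h3)
    · have hZt : Z t = U (Finsupp.mapDomain π t) := by
        ext1 x
        simp only [Z]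
        rw [Finset.powersetCard_eq_empty.2 (by omega), Finset.sum_empty, add_zero]
      rw [hZt]
      refine ⟨hT.good y _ (map_nonneg_coe π t ht0) (by rw [degree_map, ht1]) ?_ ?_, ?_⟩
      · exact (Finset.card_le_card Finsupp.mapDomain_support).trans (Finset.card_image_le.trans hge)
      · intro j hj
        obtain ⟨j', hj', rfl⟩ := Finset.mem_image.1 (Finsupp.mapDomain_support hj)
        exact subset_closure (hyW0' j' hj').1.1
      · intro x _
        exact (hT.close _ x).trans (by linarith [hγ0 x])

theorem exists_tower {X Y E : Type*} [TopologicalSpace X] [TopologicalSpace Y] [T2Space X]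
    [T2Space Y] [NormalSpace X] [ParacompactSpace Y] [Nonempty Y]
    [NormedAddCommGroup E] [NormedSpace ℝ E] [FiniteDimensional ℝ E]
    {f : X → Y} (hf : IsProperMap f) {N : Set (X × X)} (hN : IsOpen N) (hNd : ∀ x, (x, x) ∈ N)
    (n : ℕ) (hdim : ∀ y, CovDimLE ↥(f ⁻¹' {y}) n) (g : X → E) (hg : Continuous g)
    (γ : X → ℝ) (hγ : Continuous γ) (hγ0 : ∀ x, 0 < γ x) (i : ℕ)
    (hr : i + 2 * n ≤ Module.finrank ℝ E) :
    ∃ V U, Tower f N g (fun x => i * γ x) i V U := by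
  induction i with
  | zero =>
    obtain ⟨v, hvo, hvc, hvl, -⟩ := precise_refinement (fun _ : Y => (univ : Set Y))
      (fun _ => isOpen_univ) (iUnion_const univ)
    refine ⟨v, fun _ => g, hvo, hvl, hvc, ?_, ?_, ?_⟩
    · intro r e; fun_prop
    · intro t x; simp
    · intro y t _ h1 h2 _
      have : t = 0 := by
        rw [← Finsupp.support_eq_empty]; exact Finset.card_eq_zero.1 (Nat.le_zero.1 h2)
      simp [this] at h1
  | succ i ih =>
    obtain ⟨V, U, hT⟩ := ih (by omega)
    obtain ⟨V', U', hT'⟩ := tower_step hf hN hNd n i (by omega) hdim g hg (fun x => i * γ x) γ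
      (by fun_prop) hγ (fun x => mul_nonneg (Nat.cast_nonneg _) (hγ0 x).le) hγ0 V U hT
    refine ⟨V', U', ?_⟩
    convert hT' using 2 with x
    push_cast; ring

theorem exists_good_approx {X Y E : Type*} [TopologicalSpace X] [TopologicalSpace Y] [T2Space X]
    [T2Space Y] [NormalSpace X] [ParacompactSpace Y] [Nonempty Y]
    [NormedAddCommGroup E] [NormedSpace ℝ E] [FiniteDimensional ℝ E]
    {f : X → Y} (hf : IsProperMap f) {N : Set (X × X)} (hN : IsOpen N) (hNd : ∀ x, (x, x) ∈ N)
    (n m : ℕ) (hdim : ∀ y, CovDimLE ↥(f ⁻¹' {y}) n) (hdimY : CovDimLE Y m)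
    (g : X → E) (hg : Continuous g)
    (β : X → ℝ) (hβ : Continuous β) (hβ0 : ∀ x, 0 < β x)
    (hr : m + 1 + 2 * n ≤ Module.finrank ℝ E) :
    ∃ h : X → E, Continuous h ∧ (∀ x, ‖h x - g x‖ ≤ β x) ∧ ∀ y, GoodAt f N h y := by
  classical
  have hm : (0 : ℝ) < (m + 1 : ℕ) := by positivity
  obtain ⟨V, U, hT⟩ := exists_tower hf hN hNd n hdim g hg (fun x => β x / (m + 1 : ℕ))
    (by fun_prop) (fun x => div_pos (hβ0 x) hm) (m + 1) hr
  obtain ⟨V', hV'o, hV'V, hV'c, hV'm⟩ := dowker m hdimY V hT.op hT.cov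
  obtain ⟨ρ, hρ⟩ := PartitionOfUnity.exists_isSubordinate (isClosed_univ (X := Y)) V' hV'o hV'c.ge
  let t : Y → Y →₀ ℝ := fun y => Finsupp.onFinset (ρ.finsupport y) (fun j => ρ j y)
    (fun j hj => by rw [PartitionOfUnity.mem_finsupport]; exact hj)
  have htj : ∀ y j, t y j = ρ j y := fun y j => rfl
  have ht0 : ∀ y j, 0 ≤ t y j := fun y j => ρ.nonneg j y
  have ht1 : ∀ y, (t y).degree = 1 := by
    intro y
    rw [← ρ.sum_finsupport (mem_univ y), Finsupp.degree_apply]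
    refine Finset.sum_subset ?_ ?_
    · exact Finsupp.support_onFinset_subset
    · intro j _ hj
      exact Finsupp.notMem_support_iff.1 hj
  have htV : ∀ y, ∀ j ∈ (t y).support, y ∈ V' j := by
    intro y j hj
    exact hρ j (subset_tsupport _ (Finsupp.mem_support_iff.1 hj))
  have htc : ∀ y, (t y).support.card ≤ m + 1 := by
    intro y
    have h1 : ((t y).support : Set Y) ⊆ {d | y ∈ V' d} := fun j hj => htV y j hj
    have h2 := (encard_le_encard h1).trans (hV'm y)
    rw [encard_coe_eq_coe_finsetCard] at h2
    exact_mod_cast h2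
  refine ⟨fun x => U (t (f x)) x, ?_, ?_, ?_⟩
  · rw [continuous_iff_continuousAt]
    intro x0
    set S := ρ.fintsupport (f x0) with hS
    let e : Fin S.card → Y := fun a => (S.equivFin.symm a : Y)
    have heinj : Function.Injective e := Subtype.val_injective.comp (Equiv.injective _)
    have heimg : S ⊆ Finset.univ.image e := by
      intro j hj
      exact Finset.mem_image.2 ⟨S.equivFin ⟨j, hj⟩, Finset.mem_univ _, by simp [e]⟩
    have hev : ∀ᶠ x in 𝓝 x0, U (push e (fun a => ρ (e a) (f x))) x = U (t (f x)) x := by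
      filter_upwards [hf.continuous.continuousAt.eventually
        (ρ.eventually_finsupport_subset (f x0))] with x hx
      have : push e (fun a => t (f x) (e a)) = t (f x) :=
        push_enum e heinj _ (Finsupp.support_onFinset_subset.trans (hx.trans heimg))
      rw [← this]; rfl
    refine ContinuousAt.congr ?_ hev
    have hcont : Continuous fun x : X => ((fun a => ρ (e a) (f x), x) : (Fin S.card → ℝ) × X) :=
      Continuous.prodMk (continuous_pi fun a => (ρ (e a)).continuous.comp hf.continuous)
        continuous_id
    exact ((hT.cont _ e).comp hcont).continuousAt
  · intro x
    refine (hT.close _ x).trans (le_of_eq ?_)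
    field_simp
  · intro y x x' hx hx' he
    refine hT.good y (t y) (ht0 y) (ht1 y) (htc y)
      (fun j hj => subset_closure (hV'V j (htV y j hj))) x x' hx hx' ?_
    simpa only [hx, hx'] using he

theorem exists_entourage {X : Type*} [TopologicalSpace X] [T2Space X] [ParacompactSpace X]
    (ω : Set (Set X)) (hω₁ : ∀ U ∈ ω, IsOpen U) (hω₂ : ⋃₀ ω = Set.univ) :
    ∃ N : Set (X × X), IsOpen N ∧ (∀ x, (x, x) ∈ N) ∧ ∀ x, ∃ W ∈ ω, ∀ x', (x, x') ∈ N → x' ∈ W := by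
  obtain ⟨v, hvo, hvc, hvl, hvω⟩ := precise_refinement (fun W : ↥ω => (W : Set X))
    (fun W => hω₁ _ W.2) (by rw [← sUnion_eq_iUnion]; exact hω₂)
  obtain ⟨F, hFc, hFo, hFv⟩ := exists_iUnion_eq_closure_subset hvo hvl.point_finite hvc
  refine ⟨(⋃ j, closure (F j) ×ˢ (v j)ᶜ)ᶜ, ?_, ?_, ?_⟩
  · rw [isOpen_compl_iff]
    refine LocallyFinite.isClosed_iUnion ?_ fun j =>
      isClosed_closure.prod (hvo j).isClosed_compl
    rintro ⟨x, x'⟩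
    obtain ⟨t, ht, hfin⟩ := hvl x
    refine ⟨t ×ˢ univ, prod_mem_nhds ht Filter.univ_mem, hfin.subset ?_⟩
    rintro j ⟨⟨z, z'⟩, ⟨h1, -⟩, h2, -⟩
    exact ⟨z, hFv j h1, h2⟩
  · intro x hx
    obtain ⟨j, h1, h2⟩ := mem_iUnion.1 hx
    exact h2 (hFv j h1)
  · intro x
    obtain ⟨j, hj⟩ := mem_iUnion.1 (hFc ▸ mem_univ x : x ∈ ⋃ j, F j)
    refine ⟨j, j.2, fun x' hx' => ?_⟩
    by_contra hn
    exact hx' (mem_iUnion.2 ⟨j, subset_closure hj, fun h => hn (hvω j h)⟩)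

theorem omega_of_fiber {X Y M : Type*} [TopologicalSpace X] [TopologicalSpace Y]
    [TopologicalSpace M] [T2Space Y] [T2Space M] {f : X → Y} (hf : IsProperMap f)
    (ω : Set (Set X)) (hω₁ : ∀ U ∈ ω, IsOpen U) (h : X → M) (hh : Continuous h)
    (H : ∀ x, ∃ W ∈ ω, ∀ x', f x' = f x → h x' = h x → x' ∈ W) :
    IsOmegaMapOn ω (fun x => (f x, h x)) univ := by
  have hp : IsProperMap (fun x => (f x, h x)) :=
    isProperMap_of_comp_of_t2 (g := Prod.fst) (hf.continuous.prodMk hh) continuous_fst hf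
  intro x _
  obtain ⟨W, hW, hx⟩ := H x
  have hc := hp.isClosedMap _ (hω₁ W hW).isClosed_compl
  refine ⟨_, hc.isOpen_compl.mem_nhds ?_, W, hW, ?_⟩
  · rintro ⟨x', hx', he⟩
    simp only [Prod.mk.injEq] at he
    exact hx' (hx x' he.1 he.2)
  · rintro x' ⟨-, hx'⟩
    by_contra hn
    exact hx' ⟨x', hn, rfl⟩

theorem slopen_part {X Y M : Type*} [TopologicalSpace X] [TopologicalSpace Y]
    [MetricSpace M] [T2Space Y] [ParacompactSpace Y] {f : X → Y} (hf : IsProperMap f)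
    (ω : Set (Set X)) (hω₁ : ∀ U ∈ ω, IsOpen U) :
    SLOpen {g : C(X, M) | IsOmegaMapOn ω (fun x => (f x, g x) : X → Y × M) univ} := by
  intro g hg
  let G : ℝ → Set X := fun δ => {x | ∃ W ∈ ω, ∀ x', f x' = f x → dist (g x) (g x') ≤ δ → x' ∈ W}
  have hGanti : ∀ {a b : ℝ}, a ≤ b → G b ⊆ G a := by
    rintro a b hab x ⟨W, hW, hx⟩
    exact ⟨W, hW, fun x' h1 h2 => hx x' h1 (h2.trans hab)⟩
  have hGx : ∀ x0, ∃ ε > 0, x0 ∈ interior (G ε) := by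
    intro x0
    obtain ⟨V, hV, W, hW, hVW⟩ := hg x0 (mem_univ _)
    obtain ⟨A, hA, B, hB, hAB⟩ := mem_nhds_prod_iff.1 hV
    obtain ⟨ε, hε, hεB⟩ := Metric.mem_nhds_iff.1 hB
    refine ⟨ε / 2, by positivity, ?_⟩
    rw [mem_interior_iff_mem_nhds]
    filter_upwards [hf.continuous.continuousAt.eventually hA,
      g.continuous.continuousAt.eventually (Metric.ball_mem_nhds (g x0) (half_pos hε))] with x h1 h2
    refine ⟨W, hW, fun x' h3 h4 => hVW ⟨mem_univ _, hAB ⟨?_, hεB ?_⟩⟩⟩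
    · have h1' : f x ∈ A := h1
      rwa [← h3] at h1'
    · have h2' : dist (g x) (g x0) < ε / 2 := h2
      have := dist_triangle (g x') (g x) (g x0)
      rw [dist_comm (g x') (g x)] at this
      exact Metric.mem_ball.2 (by linarith)
  obtain ⟨c, hc⟩ := exists_continuous_forall_mem_convex_of_local_const
    (t := fun y => {c : ℝ | 0 < c ∧ ∀ x, f x = y → x ∈ G c}) (by
      intro y
      refine Set.OrdConnected.convex ⟨?_⟩
      rintro a ⟨ha, -⟩ b ⟨-, hb⟩ z ⟨hz1, hz2⟩
      exact ⟨ha.trans_le hz1, fun x hx => hGanti hz2 (hb x hx)⟩) (by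
      intro y0
      have hK : IsCompact (f ⁻¹' {y0}) := hf.isCompact_preimage isCompact_singleton
      obtain ⟨k, hk⟩ := hK.elim_directed_cover (fun k : ℕ => interior (G (1 / (k + 1))))
        (fun _ => isOpen_interior) (by
          intro x _
          obtain ⟨ε, hε, hx⟩ := hGx x
          obtain ⟨k, hk⟩ := exists_nat_one_div_lt hε
          exact mem_iUnion.2 ⟨k, interior_mono (hGanti hk.le) hx⟩)
        (directed_of_isDirected_le fun a b hab =>
          interior_mono (hGanti (Nat.one_div_le_one_div hab)))
      refine ⟨1 / (k + 1), ?_⟩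
      have hcl := hf.isClosedMap _ (isOpen_interior (s := G (1 / (k + 1)))).isClosed_compl
      have hy : y0 ∉ f '' (interior (G (1 / (k + 1))))ᶜ := by
        rintro ⟨x, hx, rfl⟩
        exact hx (hk rfl)
      filter_upwards [hcl.isOpen_compl.mem_nhds hy] with y hy
      refine ⟨by positivity, fun x hx => ?_⟩
      by_contra hn
      exact hy ⟨x, fun h => hn (interior_subset h), hx⟩)
  refine ⟨⟨fun x => c (f x) / 2, (c.continuous.comp hf.continuous).div_const 2⟩,
    fun x => half_pos (hc (f x)).1, ?_⟩
  intro h hh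
  refine omega_of_fiber hf ω hω₁ h h.continuous fun x => ?_
  obtain ⟨W, hW, hx⟩ := (hc (f x)).2 x rfl
  refine ⟨W, hW, fun x' h1 h2 => hx x' h1 ?_⟩
  have e1 : dist (g x) (h x) ≤ c (f x) / 2 := hh x
  have e2 : dist (g x') (h x') ≤ c (f x') / 2 := hh x'
  rw [h1, h2] at e2
  have := dist_triangle_right (g x) (g x') (h x)
  linarith

theorem sldense_part {X Y : Type*} [TopologicalSpace X] [TopologicalSpace Y]
    [T2Space X] [T2Space Y] [ParacompactSpace X] [ParacompactSpace Y]
    (n m : ℕ) {f : X → Y} (hf : IsProperMap f)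
    (hdimf : ∀ y : Y, CovDimLE ↥(f ⁻¹' {y}) n) (hdimY : CovDimLE Y m)
    (ω : Set (Set X)) (hω₁ : ∀ U ∈ ω, IsOpen U) (hω₂ : ⋃₀ ω = Set.univ) :
    SLDense {g : C(X, ↥(cube (2*n+1+m))) |
        IsOmegaMapOn ω (fun x => (f x, g x) : X → Y × ↥(cube (2*n+1+m))) Set.univ} := by
  rintro 𝒰 h𝒰 ⟨g, hg⟩
  rcases isEmpty_or_nonempty Y with hY | hY
  · exact ⟨g, hg, fun x _ => (hY.false (f x)).elim⟩
  obtain ⟨N, hN, hNd, hNω⟩ := exists_entourage ω hω₁ hω₂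
  obtain ⟨α, hα0, hα⟩ := h𝒰 g hg
  let E := EuclideanSpace ℝ (Fin (2*n+1+m))
  let c : E := WithLp.toLp 2 fun _ => (1/2 : ℝ)
  let g0 : X → E := fun x => (g x : E)
  have hg0 : Continuous g0 := continuous_subtype_val.comp g.continuous
  let s : X → ℝ := fun x => min (1/2) (α x / (2 * (1 + ‖c - g0 x‖)))
  have hden : ∀ x, 0 < 2 * (1 + ‖c - g0 x‖) := fun x => by positivity
  have hs : Continuous s := by
    refine continuous_const.min (Continuous.div α.continuous (by fun_prop) fun x => (hden x).ne')
  have hs0 : ∀ x, 0 < s x := fun x => lt_min (by norm_num) (div_pos (hα0 x) (hden x))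
  have hs1 : ∀ x, s x ≤ 1/2 := fun x => min_le_left _ _
  have hs2 : ∀ x, s x * ‖c - g0 x‖ ≤ α x / 2 := by
    intro x
    have h1 : s x ≤ α x / (2 * (1 + ‖c - g0 x‖)) := min_le_right _ _
    rw [le_div_iff₀ (hden x)] at h1
    nlinarith [hs0 x]
  let g' : X → E := fun x => g0 x + s x • (c - g0 x)
  have hg' : Continuous g' := by fun_prop
  let β : X → ℝ := fun x => min (s x / 2) (α x / 2)
  have hβ : Continuous β := by
    have := α.continuous
    fun_prop
  have hβ0 : ∀ x, 0 < β x := fun x => lt_min (half_pos (hs0 x)) (half_pos (hα0 x))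
  obtain ⟨h, hh, hhg, hgood⟩ := exists_good_approx hf hN hNd n m hdimf hdimY g' hg' β hβ hβ0
    (by simp only [E, finrank_euclideanSpace, Fintype.card_fin]; omega)
  have hcube : ∀ x, h x ∈ cube (2*n+1+m) := by
    intro x i
    have h1 : |h x i - g' x i| ≤ s x / 2 := by
      have := PiLp.norm_apply_le (h x - g' x) i
      rw [PiLp.sub_apply, Real.norm_eq_abs] at this
      exact this.trans ((hhg x).trans (min_le_left _ _))
    have h2 : g' x i = g0 x i + s x * (1/2 - g0 x i) := by
      rfl
    have h3 := (g x).2 i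
    have h4 : 0 ≤ g0 x i := h3.1
    have h5 : g0 x i ≤ 1 := h3.2
    have h6 := hs0 x
    have h7 := hs1 x
    rw [abs_le, h2] at h1
    constructor
    · nlinarith [h1.1]
    · nlinarith [h1.2]
  let H : C(X, ↥(cube (2*n+1+m))) := ⟨fun x => ⟨h x, hcube x⟩, hh.subtype_mk _⟩
  refine ⟨H, hα ?_, ?_⟩
  · intro x
    show dist (g0 x) (h x) ≤ α x
    have h1 : dist (g0 x) (g' x) ≤ α x / 2 := by
      rw [dist_comm, dist_eq_norm]
      simp only [g', add_sub_cancel_left]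
      rw [norm_smul, Real.norm_of_nonneg (hs0 x).le]
      exact hs2 x
    have h2 : dist (g' x) (h x) ≤ α x / 2 := by
      rw [dist_comm, dist_eq_norm]
      exact (hhg x).trans (min_le_right _ _)
    linarith [dist_triangle (g0 x) (g' x) (h x)]
  · refine omega_of_fiber hf ω hω₁ H H.continuous fun x => ?_
    obtain ⟨W, hW, hx⟩ := hNω x
    refine ⟨W, hW, fun x' h1 h2 => hx x' (hgood (f x) x x' rfl h1 ?_)⟩
    exact (congrArg Subtype.val h2).symm

theorem perf_proper {X Y : Type*} [TopologicalSpace X] [TopologicalSpace Y] {f : X → Y}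
    (h : IsPerfectMap f) : IsProperMap f :=
  isProperMap_iff_isClosedMap_and_compact_fibers.2 h

/-- Theorem 2.1. Let `f : X → Y` be a perfect surjection between paracompact
Hausdorff spaces with `dim f ≤ n` and `dim Y ≤ m`, and let `ω` be an open cover of `X`. Then
`{g ∈ C(X, I^{2n+1+m}) : f × g is an ω-map}` is open and dense in `C(X, I^{2n+1+m})` with the
source limitation topology. -/
theorem stmt3 {X Y : Type*} [TopologicalSpace X] [TopologicalSpace Y]
    [T2Space X] [T2Space Y] [ParacompactSpace X] [ParacompactSpace Y]
    (n m : ℕ) (f : X → Y) (hperf : IsPerfectMap f) (hsurj : Function.Surjective f)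
    (hdimf : ∀ y : Y, CovDimLE ↥(f ⁻¹' {y}) n)
    (hdimY : CovDimLE Y m)
    (ω : Set (Set X)) (hω₁ : ∀ U ∈ ω, IsOpen U) (hω₂ : ⋃₀ ω = Set.univ) :
    SLOpen {g : C(X, ↥(cube (2*n+1+m))) |
        IsOmegaMapOn ω (fun x => (f x, g x) : X → Y × ↥(cube (2*n+1+m))) Set.univ} ∧
    SLDense {g : C(X, ↥(cube (2*n+1+m))) |
        IsOmegaMapOn ω (fun x => (f x, g x) : X → Y × ↥(cube (2*n+1+m))) Set.univ} := by
  exact ⟨slopen_part (perf_proper hperf) ω hω₁,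
    sldense_part n m (perf_proper hperf) hdimf hdimY ω hω₁ hω₂⟩
end
end

section
/- Let f : X → Y be a perfect surjection between paracompact Hausdorff spaces, ω an open cover of X, and k a positive integer. If g ∈ C(X, I^k) is such that the restriction of f × g to the fiber f⁻¹(y) is an ω-map for some y ∈ Y, then there exists a neighborhood U of y in Y such that the restriction of f × g to f⁻¹(U) is an ω-map. Moreover, if the restriction of f × g to f⁻¹(y) is an ω-map for every y ∈ Y, then f × g itself is an ω-map. -/
open Set Topology

noncomputable section

/-- Lemma 2.2. Let `f : X → Y` be a perfect surjection between paracompact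
Hausdorff spaces, `ω` an open cover of `X`, and `k` a positive integer. If `(f × g)|f⁻¹(y)` is an
`ω`-map for some `y`, then there is a neighborhood `U` of `y` with `(f × g)|f⁻¹(U)` an `ω`-map;
moreover, if `(f × g)|f⁻¹(y)` is an `ω`-map for every `y ∈ Y`, then `f × g` is an `ω`-map. -/
theorem stmt4 {X Y : Type*} [TopologicalSpace X] [TopologicalSpace Y]
    [T2Space X] [T2Space Y] [ParacompactSpace X] [ParacompactSpace Y]
    (f : X → Y) (hperf : IsPerfectMap f) (hsurj : Function.Surjective f)
    (ω : Set (Set X)) (hω₁ : ∀ U ∈ ω, IsOpen U) (hω₂ : ⋃₀ ω = Set.univ)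
    (k : ℕ) (hk : 0 < k) (g : C(X, ↥(cube k))) :
    (∀ y : Y, IsOmegaMapOn ω (fun x => (f x, g x) : X → Y × ↥(cube k)) (f ⁻¹' {y}) →
      ∃ U : Set Y, IsOpen U ∧ y ∈ U ∧
        IsOmegaMapOn ω (fun x => (f x, g x) : X → Y × ↥(cube k)) (f ⁻¹' U)) ∧
    ((∀ y : Y, IsOmegaMapOn ω (fun x => (f x, g x) : X → Y × ↥(cube k)) (f ⁻¹' {y})) →
      IsOmegaMapOn ω (fun x => (f x, g x) : X → Y × ↥(cube k)) Set.univ) := by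
  obtain ⟨hc, hcl, hcomp⟩ := hperf
  have hfp : IsProperMap f :=
    isProperMap_iff_isClosedMap_and_compact_fibers.2 ⟨hc, hcl, fun {y} => hcomp y⟩
  set h : X → Y × ↥(cube k) := fun x => (f x, g x) with hh
  have hhc : Continuous h := hc.prodMk g.continuous
  have hhp : IsProperMap h :=
    isProperMap_of_comp_of_t2 hhc continuous_fst (by exact hfp)
  -- a fiber contained in a member of the cover has a whole tube contained in it
  have key : ∀ x : X, IsOmegaMapOn ω h (f ⁻¹' {f x}) →
      ∃ V : Set (Y × ↥(cube k)), IsOpen V ∧ h x ∈ V ∧ ∃ W ∈ ω, h ⁻¹' V ⊆ W := by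
    intro x hx
    obtain ⟨V, hV, W, hW, hsub⟩ := hx x rfl
    refine ⟨(h '' Wᶜ)ᶜ, (hhp.isClosedMap _ (hω₁ W hW).isClosed_compl).isOpen_compl, ?_, W, hW, ?_⟩
    · rintro ⟨x', hx'W, hx'⟩
      refine hx'W (hsub ⟨congrArg Prod.fst hx', ?_⟩)
      show h x' ∈ V
      rw [hx']
      exact mem_of_mem_nhds hV
    · intro x' hx'
      by_contra hn
      exact hx' ⟨x', hn, rfl⟩
  refine ⟨fun y hy => ?_, fun hall x _ => ?_⟩
  · let O : Set (Y × ↥(cube k)) := ⋃₀ {V | IsOpen V ∧ ∃ W ∈ ω, h ⁻¹' V ⊆ W}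
    have hO : IsOpen O := isOpen_sUnion fun V hV => hV.1
    refine ⟨(f '' (h ⁻¹' O)ᶜ)ᶜ, (hcl _ (hO.preimage hhc).isClosed_compl).isOpen_compl, ?_, ?_⟩
    · rintro ⟨x, hxO, rfl⟩
      obtain ⟨V, hV, hxV, hW⟩ := key x hy
      exact hxO ⟨V, ⟨hV, hW⟩, hxV⟩
    · intro x hx
      have hxO : h x ∈ O := by
        by_contra hn
        exact hx ⟨x, hn, rfl⟩
      obtain ⟨V, ⟨hV, W, hW, hsub⟩, hxV⟩ := hxO
      exact ⟨V, hV.mem_nhds hxV, W, hW, inter_subset_right.trans hsub⟩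
  · obtain ⟨V, hV, hxV, W, hW, hsub⟩ := key x (hall (f x))
    exact ⟨V, hV.mem_nhds hxV, W, hW, inter_subset_right.trans hsub⟩
end
end

section
/- Let f : X → Y be a perfect surjection between paracompact Hausdorff spaces, ω an open cover of X, k a positive integer, and K ⊂ X a closed subset. Then the set C_ω(X|K, I^k) of all g ∈ C(X, I^k) such that the restriction of f × g to K is an ω-map is open in C(X, I^k) with the source limitation topology. -/
open Set Topology

noncomputable section

/-- Lemma 2.3. Let `f : X → Y` be a perfect surjection between paracompact
Hausdorff spaces, `ω` an open cover of `X`, `k` a positive integer, and `K ⊆ X` closed. Then the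
set `C_ω(X|K, I^k)` of all `g ∈ C(X, I^k)` with `(f × g)|K` an `ω`-map is open in `C(X, I^k)`
with the source limitation topology. -/
theorem stmt5 {X Y : Type*} [TopologicalSpace X] [TopologicalSpace Y]
    [T2Space X] [T2Space Y] [ParacompactSpace X] [ParacompactSpace Y]
    (f : X → Y) (hperf : IsPerfectMap f) (hsurj : Function.Surjective f)
    (ω : Set (Set X)) (hω₁ : ∀ U ∈ ω, IsOpen U) (hω₂ : ⋃₀ ω = Set.univ)
    (k : ℕ) (hk : 0 < k) (K : Set X) (hK : IsClosed K) :
    SLOpen {g : C(X, ↥(cube k)) |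
        IsOmegaMapOn ω (fun x => (f x, g x) : X → Y × ↥(cube k)) K} := by
  
  obtain ⟨hfc, hfcl, hfib⟩ := hperf
  intro g hg
  let good : ℝ → X → Prop := fun r x0 => x0 ∈ K → ∃ N ∈ 𝓝 (f x0), ∃ W ∈ ω,
    ∀ x ∈ K, f x ∈ N → dist (g x) (g x0) < 4 * r → x ∈ W
  have mono : ∀ r s x0, r ≤ s → good s x0 → good r x0 := by
    intro r s x0 hrs h hx
    obtain ⟨N, hN, W, hW, h⟩ := h hx
    exact ⟨N, hN, W, hW, fun x hxK hxN hd => h x hxK hxN (by linarith)⟩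
  have hloc : ∀ x : X, ∃ r > 0, ∀ᶠ x0 in 𝓝 x, good r x0 := by
    intro x
    by_cases hx : x ∈ K
    · obtain ⟨V, hV, W, hW, hVW⟩ := hg x hx
      rw [nhds_prod_eq, Filter.mem_prod_iff] at hV
      obtain ⟨N, hN, B, hB, hNB⟩ := hV
      obtain ⟨e, he, heB⟩ := Metric.mem_nhds_iff.1 hB
      refine ⟨e / 8, by positivity, ?_⟩
      have h1 : ∀ᶠ x0 in 𝓝 x, N ∈ 𝓝 (f x0) :=
        hfc.continuousAt.eventually (eventually_eventually_nhds.2 hN)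
      have h2 : ∀ᶠ x0 in 𝓝 x, dist (g x0) (g x) < e / 2 :=
        g.continuous.continuousAt.eventually (Metric.ball_mem_nhds _ (by positivity))
      filter_upwards [h1, h2] with x0 h1 h2 _
      refine ⟨N, h1, W, hW, fun x' hK' hN' hd => hVW ⟨hK', hNB ⟨hN', heB ?_⟩⟩⟩
      have := dist_triangle (g x') (g x0) (g x)
      rw [Metric.mem_ball]
      linarith
    · refine ⟨1, one_pos, ?_⟩
      filter_upwards [hK.isOpen_compl.mem_nhds hx] with x0 h0 h1
      exact absurd h1 h0
  have hfiber : ∀ y : Y, ∃ r > 0, ∀ᶠ x0 in 𝓝ˢ (f ⁻¹' {y}), good r x0 := by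
    intro y
    refine (hfib y).induction_on (p := fun S => ∃ r > 0, ∀ᶠ x0 in 𝓝ˢ S, good r x0) ?_ ?_ ?_ ?_
    · exact ⟨1, one_pos, by simp⟩
    · rintro s t hst ⟨r, hr, h⟩
      exact ⟨r, hr, h.filter_mono (nhdsSet_mono hst)⟩
    · rintro s t ⟨r, hr, h⟩ ⟨r', hr', h'⟩
      refine ⟨min r r', lt_min hr hr', ?_⟩
      rw [nhdsSet_union, Filter.eventually_sup]
      exact ⟨h.mono fun x => mono _ _ x (min_le_left _ _),
        h'.mono fun x => mono _ _ x (min_le_right _ _)⟩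
    · intro x _
      obtain ⟨r, hr, h⟩ := hloc x
      obtain ⟨t, ht, hto, hxt⟩ := eventually_nhds_iff.1 h
      refine ⟨t, mem_nhdsWithin_of_mem_nhds (hto.mem_nhds hxt), r, hr, ?_⟩
      rw [hto.nhdsSet_eq]
      exact ht
  obtain ⟨a, ha⟩ := exists_continuous_forall_mem_convex_of_local_const
    (t := fun y : Y => {r : ℝ | 0 < r ∧ ∀ x0, f x0 = y → good r x0}) (by
      intro y
      apply Set.OrdConnected.convex
      refine ⟨fun r hr s hs u hu => ⟨lt_of_lt_of_le hr.1 hu.1, fun x0 hx0 =>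
        mono _ _ _ hu.2 (hs.2 x0 hx0)⟩⟩) (by
      intro y
      obtain ⟨r, hr, h⟩ := hfiber y
      refine ⟨r, ?_⟩
      have h' : ∀ᶠ y' in 𝓝 y, ∀ x0, f x0 = y' → good r x0 := by
        obtain ⟨U, hU, hsub, hUg⟩ := mem_nhdsSet_iff_exists.1 h
        have ho : IsOpen (f '' Uᶜ)ᶜ := (hfcl _ hU.isClosed_compl).isOpen_compl
        filter_upwards [ho.mem_nhds (x := y) (by
          rintro ⟨x, hx, hxy⟩
          exact hx (hsub hxy))] with y' hy' x0 hx0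
        apply hUg
        by_contra hn
        exact hy' ⟨x0, hn, hx0⟩
      filter_upwards [h'] with y' h''
      exact ⟨hr, h''⟩)
  refine ⟨⟨fun x => a (f x), a.continuous.comp hfc⟩, fun x => (ha (f x)).1, ?_⟩
  intro h hh x0 hx0
  have hh' : ∀ x, dist (g x) (h x) ≤ a (f x) := hh
  obtain ⟨hpos, hgood⟩ := ha (f x0)
  obtain ⟨N, hN, W, hW, hNW⟩ := hgood x0 rfl hx0
  have hN' : ∀ᶠ y in 𝓝 (f x0), a y < 2 * a (f x0) :=
    a.continuous.continuousAt.eventually (gt_mem_nhds (by linarith))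
  refine ⟨(N ∩ {y | a y < 2 * a (f x0)}) ×ˢ Metric.ball (h x0) (a (f x0)),
    prod_mem_nhds (Filter.inter_mem hN hN') (Metric.ball_mem_nhds _ hpos), W, hW, ?_⟩
  rintro x ⟨hxK, ⟨hxN, hxa⟩, hxb⟩
  refine hNW x hxK hxN ?_
  have h1 := hh' x
  have h2 := hh' x0
  rw [dist_comm] at h2
  have h3 : dist (h x) (h x0) < a (f x0) := hxb
  have h4 : a (f x) < 2 * a (f x0) := hxa
  have h5 := dist_triangle4 (g x) (h x) (h x0) (g x0)
  linarith
end
end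

section
/- Let f : X → Y be a perfect surjection between paracompact Hausdorff spaces, ω an open cover of X, and k a positive integer. Equip C(X, I^k) with the uniform convergence topology. Then the set-valued map ψ_ω : Y → 2^{C(X, I^k)} defined by ψ_ω(y) = {g ∈ C(X, I^k) : the restriction of f × g to f⁻¹(y) is not an ω-map} has a closed graph, i.e. {(y, g) : g ∈ ψ_ω(y)} is closed in Y × C(X, I^k). -/
open Set Topology

noncomputable section

/-- Lemma 2.4. Let `f : X → Y` be a perfect surjection between paracompact
Hausdorff spaces, `ω` an open cover of `X`, `k` a positive integer. With `C(X, I^k)` carrying the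
uniform convergence (sup-metric) topology (realized as the space `X →ᵇ I^k` of bounded continuous
maps, which coincides with `C(X, I^k)` since `I^k` is bounded), the set-valued map
`ψ_ω(y) = {g : (f × g)|f⁻¹(y) is not an ω-map}` has a closed graph. -/
theorem stmt6 {X Y : Type*} [TopologicalSpace X] [TopologicalSpace Y]
    [T2Space X] [T2Space Y] [ParacompactSpace X] [ParacompactSpace Y]
    (f : X → Y) (hperf : IsPerfectMap f) (hsurj : Function.Surjective f)
    (ω : Set (Set X)) (hω₁ : ∀ U ∈ ω, IsOpen U) (hω₂ : ⋃₀ ω = Set.univ)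
    (k : ℕ) (hk : 0 < k) :
    IsClosed {p : Y × (BoundedContinuousFunction X ↥(cube k)) |
        ¬ IsOmegaMapOn ω (fun x => (f x, p.2 x) : X → Y × ↥(cube k)) (f ⁻¹' {p.1})} := by
  classical
  obtain ⟨hfc, hfcl, hK⟩ := hperf
  rw [← isOpen_compl_iff, isOpen_iff_mem_nhds]
  rintro ⟨y0, g0⟩ hp
  have hp' : IsOmegaMapOn ω (fun x => (f x, g0 x) : X → Y × ↥(cube k)) (f ⁻¹' {y0}) :=
    not_not.mp hp
  have fib : ∀ O : Set X, IsOpen O → f ⁻¹' {y0} ⊆ O → ∀ᶠ y in 𝓝 y0, ∀ x, f x = y → x ∈ O := by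
    intro O hO hsub
    have hcl := hfcl _ hO.isClosed_compl
    have hm : (f '' Oᶜ)ᶜ ∈ 𝓝 y0 := by
      refine hcl.isOpen_compl.mem_nhds ?_
      rintro ⟨x, hx, hxy⟩
      exact hx (hsub hxy)
    filter_upwards [hm] with y hy x hx
    by_contra hxO
    exact hy ⟨x, hxO, hx⟩
  have key : {q : (Y × (BoundedContinuousFunction X ↥(cube k))) × X |
      ∃ ε > 0, ∃ W ∈ ω, ∀ x', f x' = q.1.1 → dist (q.1.2 x') (q.1.2 q.2) < ε → x' ∈ W}
      ∈ 𝓝 (y0, g0) ×ˢ 𝓝ˢ (f ⁻¹' {y0}) := by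
    refine (hK y0).mem_prod_nhdsSet_of_forall ?_
    intro x hx
    obtain ⟨V, hV, W, hW, hVW⟩ := hp' x hx
    obtain ⟨A, hA, B, hB, hAB⟩ := mem_nhds_prod_iff.mp hV
    obtain ⟨δ, hδ, hδB⟩ := Metric.mem_nhds_iff.mp hB
    have hO := fib (W ∪ {x' | δ / 2 < dist (g0 x') (g0 x)})
      ((hω₁ W hW).union (isOpen_lt continuous_const (by fun_prop))) (by
        intro x' hx'
        by_cases hd : δ / 2 < dist (g0 x') (g0 x)
        · exact Or.inr hd
        · refine Or.inl (hVW ⟨hx', hAB ⟨?_, hδB ?_⟩⟩)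
          · have h1 : f x' = f x := hx'.trans (Eq.symm hx)
            simp only [h1]
            exact mem_of_mem_nhds hA
          · simp only [Metric.mem_ball]
            linarith)
    have h1 : ∀ᶠ p : Y × (BoundedContinuousFunction X ↥(cube k)) in 𝓝 (y0, g0),
        (∀ x', f x' = p.1 → x' ∈ W ∪ {x' | δ / 2 < dist (g0 x') (g0 x)}) ∧
          dist p.2 g0 < δ / 10 := by
      rw [nhds_prod_eq]
      exact hO.prod_mk (Metric.ball_mem_nhds g0 (by positivity))
    have h2 : ∀ᶠ z in 𝓝 x, dist (g0 z) (g0 x) < δ / 10 :=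
      g0.continuous.continuousAt (Metric.ball_mem_nhds _ (by positivity))
    filter_upwards [h1.prod_mk h2]
    rintro ⟨⟨y, g⟩, z⟩ ⟨⟨ha, hb⟩, hc⟩
    refine ⟨δ / 10, by positivity, W, hW, ?_⟩
    intro x' hx' hd
    rcases ha x' hx' with h | h
    · exact h
    · exfalso
      simp only [mem_setOf_eq] at h hd hb hc
      have e1 := BoundedContinuousFunction.dist_coe_le_dist (f := g) (g := g0) x'
      have e2 := BoundedContinuousFunction.dist_coe_le_dist (f := g) (g := g0) z
      have t1 := dist_triangle4 (g0 x') (g x') (g z) (g0 z)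
      have t2 := dist_triangle (g0 x') (g0 z) (g0 x)
      rw [dist_comm (g0 x') (g x')] at t1
      linarith
  obtain ⟨P, hP, Q, hQ, hPQ⟩ := Filter.mem_prod_iff.mp key
  obtain ⟨O, hO, hKO, hOQ⟩ := mem_nhdsSet_iff_exists.mp hQ
  have h3 : ∀ᶠ p : Y × (BoundedContinuousFunction X ↥(cube k)) in 𝓝 (y0, g0),
      ∀ x, f x = p.1 → x ∈ O := by
    rw [nhds_prod_eq]
    exact (fib O hO hKO).prod_inl _
  filter_upwards [hP, h3]
  rintro ⟨y, g⟩ hpP hpO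
  refine not_not.mpr ?_
  intro z hz
  obtain ⟨ε, hε, W, hW, h⟩ := hPQ (Set.mk_mem_prod hpP (hOQ (hpO z hz)))
  refine ⟨univ ×ˢ Metric.ball (g z) ε,
    prod_mem_nhds Filter.univ_mem (Metric.ball_mem_nhds _ hε), W, hW, ?_⟩
  rintro x' ⟨hx', -, hd⟩
  exact h x' hx' hd
end
end

section
/- Let K be a compact Hausdorff space with covering dimension dim K ≤ n, let m be a nonnegative integer, set k = 2n + 1 + m, and let γ be an open cover of K. Then the set of all continuous maps g : I^m × K → I^k such that for every z ∈ I^m the restriction g|({z} × K), viewed as a map from K to I^k, is a γ-map, is dense in C(I^m × K, I^k) with respect to the uniform convergence topology. -/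
open Set Topology

noncomputable section

/-- Generic perturbation. -/
theorem generic_pert {X E ι : Type} [NormedAddCommGroup X] [NormedSpace ℝ X]
    [FiniteDimensional ℝ X] [NormedAddCommGroup E] [NormedSpace ℝ E] [FiniteDimensional ℝ E]
    [Fintype ι] [DecidableEq ι] [Nonempty ι] (q : ℕ)
    (hdim : Module.finrank ℝ X + q < Module.finrank ℝ E)
    (a : ι → X → E) (ha : ∀ i, ContDiff ℝ 1 (a i)) :
    Dense {b : ι → E | ∀ (i₀ i₁ : ι) (T : Finset ι), i₁ ≠ i₀ → i₀ ∉ T → T.card ≤ q →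
      ∀ (z : X) (c : ι → ℝ),
      a i₀ z + b i₀ ≠ (a i₁ z + b i₁) + ∑ j ∈ T, c j • ((a j z + b j) - (a i₁ z + b i₁))} := by
  classical
  let ex : ∀ i₀ : ι, ({i // i ≠ i₀} → E) →L[ℝ] (ι → E) := fun i₀ =>
    ContinuousLinearMap.pi fun i => if h : i ≠ i₀ then ContinuousLinearMap.proj ⟨i, h⟩ else 0
  have hex : ∀ i₀ (b : ι → E) i, i ≠ i₀ → ex i₀ (fun i => b i) i = b i := by
    intro i₀ b i hi
    simp [ex, hi]
  let F : ∀ (i₀ i₁ : ι) (T : Finset ι), X × ((T → ℝ) × ({i // i ≠ i₀} → E)) → (ι → E) :=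
    fun i₀ i₁ T p i => if i = i₀ then
      - a i₀ p.1 + ((a i₁ p.1 + ex i₀ p.2.2 i₁) +
        ∑ j : T, p.2.1 j • ((a j p.1 + ex i₀ p.2.2 j) - (a i₁ p.1 + ex i₀ p.2.2 i₁)))
      else ex i₀ p.2.2 i
  have hF : ∀ i₀ i₁ T, ContDiff ℝ 1 (F i₀ i₁ T) := by
    intro i₀ i₁ T
    rw [contDiff_pi]
    intro i
    have hexc : ∀ j, ContDiff ℝ 1
        (fun p : X × ((T → ℝ) × ({i // i ≠ i₀} → E)) => ex i₀ p.2.2 j) := by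
      intro j
      have h1 : ContDiff ℝ 1 (fun p : X × ((T → ℝ) × ({i // i ≠ i₀} → E)) => ex i₀ p.2.2) :=
        (ex i₀).contDiff.comp (contDiff_snd.comp contDiff_snd)
      exact (contDiff_pi.1 h1) j
    have hac : ∀ j, ContDiff ℝ 1
        (fun p : X × ((T → ℝ) × ({i // i ≠ i₀} → E)) => a j p.1) :=
      fun j => (ha j).comp contDiff_fst
    by_cases h : i = i₀
    · simp only [F, h, if_true]
      refine (hac _).neg.add (((hac _).add (hexc _)).add (ContDiff.sum fun j _ => ?_))
      refine ContDiff.smul ?_ (((hac _).add (hexc _)).sub ((hac _).add (hexc _)))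
      exact (contDiff_pi.1 (contDiff_fst.comp contDiff_snd)) j
    · simp only [F, h, if_false]
      exact hexc i
  let P := {t : ι × ι × Finset ι // t.2.2.card ≤ q}
  let B : Set (ι → E) := ⋃ t : P, range (F t.1.1 t.1.2.1 t.1.2.2)
  have hB : dimH B < Module.finrank ℝ (ι → E) := by
    simp only [B]
    rw [dimH_iUnion]
    have hc : 0 < Fintype.card ι := Fintype.card_pos
    have hle : ⨆ t : P, dimH (range (F t.1.1 t.1.2.1 t.1.2.2)) ≤
        ((Module.finrank ℝ X + q + (Fintype.card ι - 1) * Module.finrank ℝ E : ℕ) : ENNReal) := by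
      refine iSup_le fun t => ((hF _ _ _).dimH_range_le).trans ?_
      norm_cast
      rw [Module.finrank_prod, Module.finrank_prod, Module.finrank_pi,
        Module.finrank_pi_fintype]
      have := t.2
      simp [Fintype.card_subtype_compl]
      omega
    refine hle.trans_lt ?_
    norm_cast
    rw [Module.finrank_pi_fintype]
    simp only [Finset.sum_const, Finset.card_univ, smul_eq_mul]
    obtain ⟨N, hN⟩ : ∃ N, Fintype.card ι = N + 1 := ⟨_, (Nat.succ_pred_eq_of_pos hc).symm⟩
    rw [hN]; simp only [Nat.add_sub_cancel]
    nlinarith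
  refine (dense_compl_of_dimH_lt_finrank hB).mono ?_
  intro b hb i₀ i₁ T h10 h0T hT z c heq
  apply hb
  refine mem_iUnion.2 ⟨⟨(i₀, i₁, T), hT⟩, (z, (fun j => c j), fun i => b i), ?_⟩
  funext i
  by_cases h : i = i₀
  · subst h
    simp only [F, if_true]
    rw [hex _ _ _ h10]
    have : ∀ j : T, ex i (fun j => b j) (j : ι) = b j := fun j => hex _ _ _ (fun h => h0T (h ▸ j.2))
    simp only [this]
    rw [Finset.sum_coe_sort T (fun j => c j • ((a j z + b j) - (a i₁ z + b i₁))), ← heq]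
    abel
  · simp only [F, h, if_false]
    exact hex _ _ _ h

theorem cube_compact (k : ℕ) : CompactSpace (cube k) := by
  rw [← isCompact_iff_compactSpace]
  have : cube k = (EuclideanSpace.equiv (Fin k) ℝ).toHomeomorph ⁻¹' (Set.pi univ fun _ => Icc 0 1) := by
    ext x; exact ⟨fun h i _ => h i, fun h i => h i trivial⟩
  rw [this]
  exact (Homeomorph.isCompact_preimage _).2 (isCompact_univ_pi fun _ => isCompact_Icc)

theorem cube_approx (m k : ℕ) (f : C(cube m, Fin k → ℝ)) (δ : ℝ) (hδ : 0 < δ) :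
    ∃ a : EuclideanSpace ℝ (Fin m) → (Fin k → ℝ), ContDiff ℝ 1 a ∧
      ∀ z : cube m, dist (a z) (f z) < δ := by
  let r : EuclideanSpace ℝ (Fin m) → cube m := fun z =>
    ⟨WithLp.toLp 2 fun i => (projIcc (0:ℝ) 1 zero_le_one (z i) : ℝ), fun i => by
      exact (projIcc (0:ℝ) 1 zero_le_one (z i)).2⟩
  have hr : Continuous r := by
    refine Continuous.subtype_mk ?_ _
    refine (PiLp.continuous_toLp 2 _).comp ?_
    refine continuous_pi fun i => continuous_subtype_val.comp (continuous_projIcc.comp ?_)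
    fun_prop
  have hrz : ∀ z : cube m, r z = z := by
    intro z
    ext i
    simp only [r]
    rw [projIcc_of_mem zero_le_one (z.2 i)]
  obtain ⟨a, ha, hd, -⟩ := (f.continuous.comp hr).exists_contDiff_approx 1
    (ε := fun _ => δ) continuous_const (fun _ => hδ)
  refine ⟨a, ha, fun z => ?_⟩
  have := hd z
  simpa [hrz z] using this

/-- An injectivity statement for generic combinations. -/
theorem coeff_eq {E ι : Type} [AddCommGroup E] [Module ℝ E] [Fintype ι] [DecidableEq ι]
    (n : ℕ) (p : ι → E)
    (hp : ∀ (i₀ i₁ : ι) (T : Finset ι), i₁ ≠ i₀ → i₀ ∉ T → T.card ≤ 2 * n → ∀ c : ι → ℝ,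
      p i₀ ≠ p i₁ + ∑ j ∈ T, c j • (p j - p i₁))
    (S : Finset ι) (hS : S.card ≤ 2 * n + 2)
    (c : ι → ℝ) (hc0 : ∀ i ∉ S, c i = 0) (hsum : ∑ i, c i = 0) (hcp : ∑ i, c i • p i = 0) :
    ∀ i, c i = 0 := by
  by_contra! h
  obtain ⟨i₀, hi₀⟩ := h
  have h0S : i₀ ∈ S := by by_contra h; exact hi₀ (hc0 _ h)
  obtain ⟨i₁, h10, hi₁⟩ : ∃ i₁, i₁ ≠ i₀ ∧ c i₁ ≠ 0 := by
    by_contra! h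
    rw [Finset.sum_eq_single i₀ (fun b _ hb => h b hb) (by simp)] at hsum
    exact hi₀ hsum
  have h1S : i₁ ∈ S := by by_contra h; exact hi₁ (hc0 _ h)
  set T := (S.erase i₀).erase i₁ with hT
  have h1S' : i₁ ∈ S.erase i₀ := Finset.mem_erase.2 ⟨h10, h1S⟩
  have hcard : T.card ≤ 2 * n := by
    rw [hT, Finset.card_erase_of_mem h1S', Finset.card_erase_of_mem h0S]; omega
  refine hp i₀ i₁ T h10 (by simp [hT]) hcard (fun j => -(c i₀)⁻¹ * c j) ?_
  have e1 : ∑ i, c i • (p i - p i₁) = 0 := by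
    simp only [smul_sub, Finset.sum_sub_distrib]
    rw [hcp, ← Finset.sum_smul, hsum]; simp
  have e2 : ∑ i ∈ S, c i • (p i - p i₁) = 0 := by
    rw [← e1]
    refine Finset.sum_subset (Finset.subset_univ _) fun i _ hi => by rw [hc0 i hi, zero_smul]
  rw [← Finset.add_sum_erase _ _ h0S, ← Finset.add_sum_erase _ _ h1S', sub_self, smul_zero,
    zero_add, ← hT] at e2
  have e3 : ∑ j ∈ T, (-(c i₀)⁻¹ * c j) • (p j - p i₁) = p i₀ - p i₁ := by
    simp only [mul_smul]
    rw [← Finset.smul_sum, eq_neg_of_add_eq_zero_right e2, smul_neg, neg_smul, neg_neg,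
      smul_smul, inv_mul_cancel₀ hi₀, one_smul]
  rw [e3]; abel

/-- Lemma 2.5. Let `K` be a compact Hausdorff space with `dim K ≤ n`, let
`k = 2n + 1 + m`, and let `γ` be an open cover of `K`. Then the maps `g : I^m × K → I^k` all of
whose restrictions `g|({z} × K)` are `γ`-maps form a dense subset of `C(I^m × K, I^k)` with the
uniform convergence topology (realized via bounded continuous maps, whose sup metric gives exactly
the uniform convergence topology; every continuous map into the bounded set `I^k` is bounded). -/
theorem stmt7 {K : Type*} [TopologicalSpace K] [CompactSpace K] [T2Space K]
    (n m : ℕ) (hdimK : CovDimLE K n)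
    (γ : Set (Set K)) (hγ₁ : ∀ U ∈ γ, IsOpen U) (hγ₂ : ⋃₀ γ = Set.univ) :
    Dense {g : BoundedContinuousFunction (↥(cube m) × K) ↥(cube (2*n+1+m)) |
        ∀ z : ↥(cube m), IsOmegaMapOn γ (fun t => g (z, t)) Set.univ} := by
  classical
  have := cube_compact m
  set k := 2 * n + 1 + m with hk
  rw [Metric.dense_iff]
  intro g₀ ε hε
  by_cases hK : IsEmpty K
  · exact ⟨g₀, Metric.mem_ball_self hε, fun z x => (hK.false x).elim⟩
  have hKne : Nonempty K := not_isEmpty_iff.1 hK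
  -- uniform continuity of the change of norm
  obtain ⟨δ₀, hδ₀, hLp⟩ := Metric.uniformContinuous_iff.1
    (PiLp.uniformContinuous_toLp 2 (fun _ : Fin k => ℝ)) (ε / 2) (half_pos hε)
  obtain ⟨δ, hδ, hδ6⟩ : ∃ δ : ℝ, 0 < δ ∧ 6 * δ < δ₀ := ⟨δ₀ / 7, by positivity, by linarith⟩
  -- the coordinates of `g₀`
  let f : C(K × cube m, Fin k → ℝ) := ⟨fun p => WithLp.ofLp (g₀ (p.2, p.1)).1, by
    refine (PiLp.continuous_ofLp 2 _).comp (continuous_subtype_val.comp ?_)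
    exact g₀.continuous.comp continuous_swap⟩
  let fc : C(K, C(cube m, Fin k → ℝ)) := f.curry
  -- a fine cover
  have hcov : ∀ t : K, ∃ U : Set K, IsOpen U ∧ t ∈ U ∧ (∃ W ∈ γ, U ⊆ W) ∧
      ∀ s ∈ U, dist (fc s) (fc t) < δ := by
    intro t
    obtain ⟨W, hW, htW⟩ : t ∈ ⋃₀ γ := by rw [hγ₂]; trivial
    refine ⟨W ∩ fc ⁻¹' Metric.ball (fc t) δ,
      (hγ₁ W hW).inter (Metric.isOpen_ball.preimage fc.continuous),
      ⟨htW, Metric.mem_ball_self hδ⟩, ⟨W, hW, inter_subset_left⟩, fun s hs => hs.2⟩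
  choose U hUo hUt hUγ hUd using hcov
  obtain ⟨S, hS⟩ := isCompact_univ.elim_finite_subcover U hUo
    (fun t _ => mem_iUnion.2 ⟨t, hUt t⟩)
  let e := S.equivFin.symm
  let τ : Fin S.card → K := fun i => (e i : K)
  have hcover : ⋃ i, U (τ i) = univ := by
    refine eq_univ_of_forall fun t => ?_
    obtain ⟨s, hs, hts⟩ := mem_iUnion₂.1 (hS (mem_univ t))
    exact mem_iUnion.2 ⟨e.symm ⟨s, hs⟩, by simpa [τ] using hts⟩
  obtain ⟨V, hVo, hVU, hVc, hVn⟩ := hdimK (Fin S.card) (fun i => U (τ i)) inferInstance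
    (fun i => hUo _) hcover
  have : Nonempty (Fin S.card) := by
    obtain ⟨t⟩ := hKne
    have : t ∈ ⋃ i, V i := by rw [hVc]; trivial
    exact ⟨(mem_iUnion.1 this).choose⟩
  obtain ⟨φ, hφ⟩ := PartitionOfUnity.exists_isSubordinate isClosed_univ V hVo hVc.ge
  have hφV : ∀ i t, φ i t ≠ 0 → t ∈ V i := fun i t h => hφ i (subset_closure h)
  have hφ1 : ∀ t, ∑ i, φ i t = 1 := fun t => by
    rw [← finsum_eq_sum_of_fintype]; exact φ.sum_eq_one (mem_univ t)
  have hφ0 : ∀ i t, 0 ≤ φ i t := fun i t => φ.nonneg i t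
  -- smooth approximations and generic perturbation
  choose a ha had using fun i => cube_approx m k (fc (τ i)) δ hδ
  have hdense := generic_pert (E := Fin k → ℝ) (2 * n) (by simp [hk]; omega) a ha
  obtain ⟨b, hbδ, hb⟩ := Metric.dense_iff.1 hdense 0 δ hδ
  have hbi : ∀ i, ‖b i‖ < δ := fun i =>
    (norm_le_pi_norm b i).trans_lt (by simpa using hbδ)
  let G : cube m × K → Fin k → ℝ := fun p => ∑ i, φ i p.2 • (a i p.1 + b i)
  have hGc : Continuous G := by
    refine continuous_finsetSum _ fun i _ => ?_
    refine ((φ i).continuous.comp continuous_snd).smul (Continuous.add ?_ continuous_const)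
    exact (ha i).continuous.comp (continuous_subtype_val.comp continuous_fst)
  have hGd : ∀ p : cube m × K, ‖G p - f (p.2, p.1)‖ ≤ 3 * δ := by
    rintro ⟨z, t⟩
    have h1 : G (z, t) - f (t, z) = ∑ i, φ i t • (a i z + b i - f (t, z)) := by
      simp only [smul_sub, Finset.sum_sub_distrib, ← Finset.sum_smul, hφ1, one_smul, G]
    rw [h1]
    calc ‖∑ i, φ i t • (a i z + b i - f (t, z))‖
        ≤ ∑ i, φ i t * (3 * δ) := by
          refine norm_sum_le_of_le _ fun i _ => ?_
          rw [norm_smul, Real.norm_of_nonneg (hφ0 i t)]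
          by_cases h : φ i t = 0
          · simp [h]
          refine mul_le_mul_of_nonneg_left ?_ (hφ0 i t)
          have hd1 := had i z
          have hd2 := (ContinuousMap.dist_apply_le_dist z).trans_lt
            (hUd (τ i) t (hVU i (hφV i t h)))
          have hd3 := hbi i
          rw [dist_comm] at hd2
          rw [dist_eq_norm] at hd1 hd2
          have : a i z + b i - f (t, z) =
              (a i z - fc (τ i) z) + b i + (fc (τ i) z - fc t z) := by
            have : fc t z = f (t, z) := rfl
            rw [this]; abel
          rw [this]
          refine (norm_add₃_le).trans ?_
          linarith
      _ = 3 * δ := by rw [← Finset.sum_mul, hφ1, one_mul]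
  -- shrink into the cube
  let D : ℝ := 3 * δ
  have hD : 0 < D := by positivity
  have hGi : ∀ p i, -D ≤ G p i ∧ G p i ≤ 1 + D ∧ |G p i - f (p.2, p.1) i| ≤ D := by
    intro p i
    have h1 : |G p i - f (p.2, p.1) i| ≤ D := (norm_le_pi_norm (G p - f (p.2, p.1)) i).trans (hGd p)
    have h2 : f (p.2, p.1) i ∈ Icc (0:ℝ) 1 := (g₀ (p.1, p.2)).2 i
    have h3 := abs_le.1 h1
    exact ⟨by linarith [h2.1, h3.1], by linarith [h2.2, h3.2], h1⟩
  have hD1 : 0 < 1 + 2 * D := by positivity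
  let A : (Fin k → ℝ) → (Fin k → ℝ) := fun x i => (x i + D) / (1 + 2 * D)
  have hAc : Continuous A := by fun_prop
  have hAinj : ∀ x y, A x = A y → x = y := by
    intro x y h
    funext i
    have := congrFun h i
    simp only [A] at this
    rw [div_left_inj' hD1.ne'] at this
    linarith
  have hAG : ∀ p, WithLp.toLp 2 (A (G p)) ∈ cube k := by
    intro p i
    obtain ⟨h1, h2, -⟩ := hGi p i
    exact ⟨div_nonneg (by linarith) hD1.le, (div_le_one hD1).2 (by linarith)⟩
  let g : BoundedContinuousFunction (cube m × K) (cube k) :=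
    BoundedContinuousFunction.mkOfCompact ⟨fun p => ⟨WithLp.toLp 2 (A (G p)), hAG p⟩,
      Continuous.subtype_mk ((PiLp.continuous_toLp 2 _).comp (hAc.comp hGc)) _⟩
  refine ⟨g, ?_, ?_⟩
  · rw [Metric.mem_ball]
    refine lt_of_le_of_lt ((BoundedContinuousFunction.dist_le (half_pos hε).le).2 ?_)
      (half_lt_self hε)
    intro p
    have hsup : dist (A (G p)) (f (p.2, p.1)) < δ₀ := by
      refine lt_of_le_of_lt ((dist_pi_le_iff (by positivity : (0:ℝ) ≤ 6 * δ)).2 fun i => ?_) hδ6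
      obtain ⟨h1, h2, h3⟩ := hGi p i
      have h4 : |A (G p) i - G p i| ≤ D := by
        have : A (G p) i - G p i = D * (1 - 2 * G p i) / (1 + 2 * D) := by
          simp only [A]; field_simp; ring
        rw [this, abs_div, abs_of_pos hD1, abs_mul, abs_of_pos hD, div_le_iff₀ hD1]
        refine mul_le_mul_of_nonneg_left ?_ hD.le
        rw [abs_le]; constructor <;> linarith
      rw [Real.dist_eq]
      have h5 := abs_add_le (A (G p) i - G p i) (G p i - f (p.2, p.1) i)
      rw [sub_add_sub_cancel] at h5
      have : D = 3 * δ := rfl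
      linarith
    exact (hLp hsup).le
  · intro z t _
    obtain ⟨i, hi⟩ : ∃ i, φ i t ≠ 0 := by
      by_contra! h
      have := hφ1 t
      simp [h] at this
    obtain ⟨W, hW, hUW⟩ := hUγ (τ i)
    have hc : Continuous fun s => g (z, s) := g.continuous.comp (by fun_prop)
    have hcl : IsClosed ((fun s => g (z, s)) '' (V i)ᶜ) :=
      ((hVo i).isClosed_compl.isCompact.image hc).isClosed
    refine ⟨((fun s => g (z, s)) '' (V i)ᶜ)ᶜ, hcl.isOpen_compl.mem_nhds ?_, W, hW, ?_⟩
    · rintro ⟨s, hs, hst⟩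
      apply hs
      apply hφV
      have hGst : G (z, s) = G (z, t) := by
        apply hAinj
        have h1 : (g (z, s) : EuclideanSpace ℝ (Fin k)) = g (z, t) := congrArg _ hst
        exact congrArg WithLp.ofLp h1
      let Q : Finset (Fin S.card) := Finset.univ.filter (fun i => s ∈ V i) ∪
        Finset.univ.filter (fun i => t ∈ V i)
      have hQ1 : ∀ x : K, (Finset.univ.filter (fun i => x ∈ V i)).card ≤ n + 1 := by
        intro x
        have := hVn x
        rw [Set.ncard_eq_toFinset_card'] at this
        have h2 : ({i | x ∈ V i} : Set (Fin S.card)).toFinset =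
            Finset.univ.filter (fun i => x ∈ V i) := by ext; simp
        rw [h2] at this
        exact_mod_cast this
      have hQ : Q.card ≤ 2 * n + 2 := by
        refine (Finset.card_union_le _ _).trans ?_
        have := hQ1 s
        have := hQ1 t
        omega
      have key := coeff_eq n (fun i => a i z + b i)
        (fun i₀ i₁ T h1 h2 h3 c => hb i₀ i₁ T h1 h2 h3 z c) Q hQ
        (fun i => φ i s - φ i t) ?_ ?_ ?_ i
      · rw [sub_eq_zero] at key
        rw [key]; exact hi
      · intro j hj
        simp only [Q, Finset.mem_union, Finset.mem_filter, Finset.mem_univ, true_and, not_or] at hj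
        have h1 : φ j s = 0 := by by_contra h; exact hj.1 (hφV j s h)
        have h2 : φ j t = 0 := by by_contra h; exact hj.2 (hφV j t h)
        simp [h1, h2]
      · simp [Finset.sum_sub_distrib, hφ1]
      · simp only [sub_smul, Finset.sum_sub_distrib]
        exact sub_eq_zero.2 hGst
    · rintro s ⟨-, hs⟩
      apply hUW
      apply hVU
      by_contra h
      exact hs ⟨s, h, rfl⟩
end
end

section
/- Let f : X → Y be a perfect surjection between paracompact Hausdorff spaces with dim f ≤ n and dim Y ≤ m, set k = 2n + 1 + m, let ω be an open cover of X, let α : X → (0, ∞) be continuous and g₀ ∈ C(X, I^k). Consider B̄(g₀, α) = {g ∈ C(X, I^k) : d_k(g₀(x), g(x)) ≤ α(x) for all x} as a subspace of C(X, I^k) with the uniform convergence topology. Then for every y ∈ Y the set ψ_ω(y) ∩ B̄(g₀, α) is a Z_m-set in B̄(g₀, α), where ψ_ω(y) = {g ∈ C(X, I^k) : the restriction of f × g to f⁻¹(y) is not an ω-map}. -/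
open Set Topology

noncomputable section

open Module in
lemma gp_core {E F ι : Type} [NormedAddCommGroup E] [NormedSpace ℝ E] [FiniteDimensional ℝ E]
    [NormedAddCommGroup F] [NormedSpace ℝ F] [FiniteDimensional ℝ F] [Finite ι] (n : ℕ)
    (hdim : finrank ℝ E + 2 * n < finrank ℝ F)
    (P : ι → E → F) (hP : ∀ i, ContDiff ℝ 1 (P i)) (η : ℝ) (hη : 0 < η) (S : Finset ι) :
    ∃ c : ι → F, (∀ i, ‖c i‖ < η) ∧ ∀ z : E, ∀ l : ι → ℝ, ∀ T ⊆ S, T.card ≤ 2 * n + 2 →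
      ∑ i ∈ T, l i = 0 → ∑ i ∈ T, l i • (P i z + c i) = 0 → ∀ i ∈ T, l i = 0 := by
  classical
  have := Fintype.ofFinite ι
  induction S using Finset.induction_on with
  | empty =>
    refine ⟨fun _ => 0, by simpa using fun _ => hη, ?_⟩
    intro z l T hT _ _ _ i hi
    exact absurd (hT hi) (by simp)
  | insert a S ha ih =>
    obtain ⟨c, hc, hgp⟩ := ih
    let Q : ι → E → F := fun i z => P i z + c i
    have hQ : ∀ i, ContDiff ℝ 1 (Q i) := fun i => (hP i).add contDiff_const
    let Φ : (t : ι × {T : Finset ι // T.card ≤ 2 * n}) → E × (t.2.1 → ℝ) → F := fun t w =>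
      Q t.1 w.1 + ∑ i : t.2.1, w.2 i • (Q i w.1 - Q t.1 w.1) - P a w.1
    have hΦ : ∀ t, ContDiff ℝ 1 (Φ t) := by
      intro t
      refine (((hQ _).comp contDiff_fst).add (ContDiff.sum fun i _ => ?_)).sub
        ((hP a).comp contDiff_fst)
      refine ContDiff.smul ?_ (((hQ _).comp contDiff_fst).sub ((hQ _).comp contDiff_fst))
      exact (contDiff_apply ℝ ℝ i).comp contDiff_snd
    have hd : dimH (⋃ t, range (Φ t)) < finrank ℝ F := by
      rw [dimH_iUnion]
      refine lt_of_le_of_lt (b := ((finrank ℝ E + 2 * n : ℕ) : ENNReal)) (iSup_le fun t => ?_)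
        (by exact_mod_cast hdim)
      refine (hΦ t).dimH_range_le.trans ?_
      have := t.2.2
      have h2 : finrank ℝ (E × (t.2.1 → ℝ)) ≤ finrank ℝ E + 2 * n := by
        rw [Module.finrank_prod, Module.finrank_fintype_fun_eq_card, Fintype.card_coe]
        omega
      exact_mod_cast h2
    obtain ⟨v, hv, hvη⟩ := (dense_compl_of_dimH_lt_finrank hd).exists_dist_lt 0 hη
    refine ⟨Function.update c a v, ?_, ?_⟩
    · intro i
      by_cases h : i = a
      · subst h; simpa using hvη
      · simpa [Function.update_of_ne h] using hc i
    · intro z l T hT hcard hs hsum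
      have hsame : ∀ T' ⊆ S, ∑ i ∈ T', l i • (P i z + Function.update c a v i)
          = ∑ i ∈ T', l i • (P i z + c i) := by
        intro T' hT'
        refine Finset.sum_congr rfl fun i hi => ?_
        have : i ≠ a := fun h => ha (h ▸ hT' hi)
        rw [Function.update_of_ne this]
      by_cases haT : a ∈ T
      · have hsub : T.erase a ⊆ S := by
          intro i hi
          have h1 := hT (Finset.mem_of_mem_erase hi)
          exact (Finset.mem_insert.1 h1).resolve_left (Finset.ne_of_mem_erase hi)
        rw [← Finset.add_sum_erase _ _ haT] at hs hsum
        rw [hsame _ hsub, Function.update_self] at hsum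
        have hcd : (T.erase a).card + 1 = T.card := Finset.card_erase_add_one haT
        by_cases hla : l a = 0
        · rw [hla, zero_add] at hs
          rw [hla, zero_smul, zero_add] at hsum
          have := hgp z l _ hsub (by omega) hs hsum
          intro i hi
          by_cases h : i = a
          · rw [h, hla]
          · exact this i (Finset.mem_erase.2 ⟨h, hi⟩)
        · exfalso
          have hne : (T.erase a).Nonempty := by
            rw [Finset.nonempty_iff_ne_empty]
            intro h
            rw [h] at hs
            exact hla (by simpa using hs)
          obtain ⟨t0, ht0⟩ := hne
          set T' := (T.erase a).erase t0 with hT'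
          have hcd' : T'.card + 1 = (T.erase a).card := Finset.card_erase_add_one ht0
          rw [← Finset.add_sum_erase _ _ ht0] at hs hsum
          apply hv
          refine mem_iUnion.2 ⟨(t0, ⟨T', by omega⟩), ⟨(z, fun i => - l i / l a), ?_⟩⟩
          have e1 : ∑ i : T', (- l i / l a) • (Q i z - Q t0 z)
              = ∑ i ∈ T', (- l i / l a) • (Q i z - Q t0 z) :=
            Finset.sum_coe_sort T' (fun i => (- l i / l a) • (Q i z - Q t0 z))
          change Q t0 z + ∑ i : T', (- l i / l a) • (Q i z - Q t0 z) - P a z = v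
          rw [e1]
          have e2 : ∑ i ∈ T', (- l i / l a) • (Q i z - Q t0 z)
              = -(l a)⁻¹ • (∑ i ∈ T', l i • Q i z) + ((l a)⁻¹ * ∑ i ∈ T', l i) • Q t0 z := by
            rw [Finset.smul_sum, Finset.mul_sum, Finset.sum_smul, ← Finset.sum_add_distrib]
            refine Finset.sum_congr rfl fun i _ => ?_
            rw [smul_smul, smul_sub, div_eq_mul_inv]
            module
          have e3 : ∑ i ∈ T', l i • Q i z = -(l a • (P a z + v)) - l t0 • Q t0 z := by
            rw [eq_sub_iff_add_eq, eq_neg_iff_add_eq_zero, ← hsum]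
            simp only [Q, hT']
            abel
          have e4 : ∑ i ∈ T', l i = - l a - l t0 := by linarith
          rw [e2, e3, e4]
          have e5 : (l a)⁻¹ * (- l a - l t0) = -1 - (l a)⁻¹ * l t0 := by field_simp
          rw [e5]
          have e6 : -(l a)⁻¹ • (-(l a • (P a z + v)) - l t0 • Q t0 z)
              = P a z + v + ((l a)⁻¹ * l t0) • Q t0 z := by
            rw [smul_sub, smul_neg, smul_smul, smul_smul, neg_mul, inv_mul_cancel₀ hla]
            module
          rw [e6]
          module
      · have hTS : T ⊆ S := by
          intro i hi
          exact (Finset.mem_insert.1 (hT hi)).resolve_left (fun h => haT (h ▸ hi))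
        rw [hsame T hTS] at hsum
        exact hgp z l T hTS hcard hs hsum

lemma cube_isClosed (k : ℕ) : IsClosed (cube k) := by
  have : cube k = ⋂ i, (fun x : EuclideanSpace ℝ (Fin k) => x i) ⁻¹' Icc (0:ℝ) 1 := by
    ext x; simp [cube]
  rw [this]
  exact isClosed_iInter fun i => isClosed_Icc.preimage (by fun_prop)

lemma cube_convex (k : ℕ) : Convex ℝ (cube k) := by
  intro x hx y hy a b ha hb hab i
  have := (convex_Icc (0:ℝ) 1) (hx i) (hy i) ha hb hab
  simpa using this

lemma cube_isBounded (k : ℕ) : Bornology.IsBounded (cube k) := by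
  rw [isBounded_iff_forall_norm_le]
  refine ⟨Real.sqrt k, fun x hx => ?_⟩
  rw [EuclideanSpace.norm_eq]
  apply Real.sqrt_le_sqrt
  have : ∀ i ∈ (Finset.univ : Finset (Fin k)), ‖x i‖ ^ 2 ≤ 1 := by
    intro i _
    have := hx i
    rw [Real.norm_eq_abs, sq_abs]
    nlinarith [this.1, this.2]
  simpa using Finset.sum_le_sum this

lemma cube_isCompact (k : ℕ) : IsCompact (cube k) :=
  Metric.isCompact_of_isClosed_isBounded (cube_isClosed k) (cube_isBounded k)

instance (k : ℕ) : CompactSpace ↥(cube k) := isCompact_iff_compactSpace.1 (cube_isCompact k)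

/-- a map into the cube can be approximated by smooth maps, with room inside the cube -/
lemma smooth_approx (m k : ℕ) (a : C(↥(cube m), EuclideanSpace ℝ (Fin k)))
    (ha : ∀ z, a z ∈ cube k) (η : ℝ) (hη : 0 < η) :
    ∃ δ > 0, ∃ P : EuclideanSpace ℝ (Fin m) → EuclideanSpace ℝ (Fin k), ContDiff ℝ 1 P ∧
      ∀ z : ↥(cube m), ∀ c, ‖c‖ < δ → P z + c ∈ cube k ∧ ‖P z + c - a z‖ < η := by
  obtain ⟨R, hR0, hR⟩ : ∃ R > 0, ∀ x ∈ cube k, ‖x‖ ≤ R := by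
    obtain ⟨R, h0, hR⟩ := (cube_isBounded k).exists_pos_norm_le
    exact ⟨R, h0, hR⟩
  let o : EuclideanSpace ℝ (Fin k) := WithLp.toLp 2 (fun _ => 1/2)
  have ho : o ∈ cube k := fun i => by simp only [o]; norm_num
  obtain ⟨τ, hτ0, hτ1, hτ⟩ : ∃ τ : ℝ, 0 < τ ∧ τ ≤ 1 ∧ τ * (2 * R) + τ / 2 < η := by
    refine ⟨min 1 (η / (2 * (2 * R + 1))), by positivity, min_le_left _ _, ?_⟩
    have : min 1 (η / (2 * (2 * R + 1))) * (2 * R + 1) ≤ η / 2 := by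
      calc _ ≤ (η / (2 * (2 * R + 1))) * (2 * R + 1) := by
            gcongr; exact min_le_right _ _
        _ = η / 2 := by field_simp
    have h2 : 0 < min 1 (η / (2 * (2 * R + 1))) := by positivity
    linarith
  obtain ⟨b, hb⟩ := ContinuousMap.exists_restrict_eq (cube_isClosed m) a
  have hb' : ∀ z : ↥(cube m), b z = a z := fun z => by rw [← hb]; rfl
  obtain ⟨P, hP, hPb, -⟩ := Continuous.exists_contDiff_approx 1
    (f := fun z => b z + τ • (o - b z)) (by fun_prop) (ε := fun _ => τ / 4) (by fun_prop)
    (fun _ => by positivity)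
  refine ⟨τ / 4, by positivity, P, by exact_mod_cast hP, ?_⟩
  intro z c hc
  have h1 : ‖P z + c - (a z + τ • (o - a z))‖ < τ / 2 := by
    have := hPb z
    rw [hb', dist_eq_norm] at this
    calc _ = ‖(P z - (a z + τ • (o - a z))) + c‖ := by congr 1; abel
      _ ≤ _ := norm_add_le _ _
      _ < _ := by linarith
  constructor
  · intro i
    have h2 := (PiLp.norm_apply_le (P z + c - (a z + τ • (o - a z))) i).trans_lt h1
    have h3 := ha z i
    have h4 : (P z + c - (a z + τ • (o - a z))) i = (P z + c) i - (a z i + τ * (1/2 - a z i)) := by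
      simp [o]
    rw [h4, Real.norm_eq_abs, abs_lt] at h2
    constructor <;> nlinarith [h3.1, h3.2, h2.1, h2.2]
  · calc ‖P z + c - a z‖ = ‖(P z + c - (a z + τ • (o - a z))) + τ • (o - a z)‖ := by
          congr 1; abel
      _ ≤ _ := norm_add_le _ _
      _ ≤ τ / 2 + τ * (2 * R) := by
          rw [norm_smul, Real.norm_eq_abs, abs_of_pos hτ0]
          have : ‖o - a z‖ ≤ 2 * R := by
            have := norm_sub_le o (a z)
            linarith [hR _ ho, hR _ (ha z)]
          gcongr
      _ < η := by linarith

lemma gp_cube (n m : ℕ) {ι : Type} [Finite ι]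
    (a : ι → C(↥(cube m), EuclideanSpace ℝ (Fin (2*n+1+m))))
    (ha : ∀ i z, a i z ∈ cube (2*n+1+m)) (η : ℝ) (hη : 0 < η) :
    ∃ p : ι → C(↥(cube m), EuclideanSpace ℝ (Fin (2*n+1+m))),
      (∀ i z, p i z ∈ cube (2*n+1+m)) ∧ (∀ i z, ‖p i z - a i z‖ < η) ∧
      ∀ z, ∀ l : ι → ℝ, ∀ T : Finset ι, T.card ≤ 2 * n + 2 →
        ∑ i ∈ T, l i = 0 → ∑ i ∈ T, l i • p i z = 0 → ∀ i ∈ T, l i = 0 := by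
  have := Fintype.ofFinite ι
  choose δ hδ P hP hPa using fun i => smooth_approx m _ (a i) (ha i) η hη
  obtain ⟨δ₀, hδ₀, hle⟩ : ∃ δ₀ > 0, ∀ i, δ₀ ≤ δ i := by
    rcases isEmpty_or_nonempty ι with h | h
    · exact ⟨1, one_pos, fun i => h.elim i⟩
    · obtain ⟨i, hi⟩ := Finite.exists_min δ
      exact ⟨δ i, hδ i, hi⟩
  obtain ⟨c, hc, hgp⟩ := gp_core n (by simp; omega) P hP δ₀ hδ₀ Finset.univ
  refine ⟨fun i => ⟨fun z => P i z + c i, ?_⟩, ?_, ?_, ?_⟩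
  · have := (hP i).continuous
    fun_prop
  · exact fun i z => (hPa i z (c i) ((hc i).trans_le (hle i))).1
  · exact fun i z => (hPa i z (c i) ((hc i).trans_le (hle i))).2
  · intro z l T hT h1 h2
    exact hgp z l T (Finset.subset_univ _) hT h1 h2

set_option maxHeartbeats 400000 in
lemma density_core {X : Type*} [TopologicalSpace X] [T2Space X] [ParacompactSpace X]
    (n m : ℕ) (A : Set X) (hA : IsCompact A) (hdim : CovDimLE ↥A n)
    (ω : Set (Set X)) (hω₁ : ∀ U ∈ ω, IsOpen U) (hω₂ : ⋃₀ ω = Set.univ)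
    (q : C(X × ↥(cube m), EuclideanSpace ℝ (Fin (2*n+1+m))))
    (hq : ∀ w, q w ∈ cube (2*n+1+m)) (s : C(X, ℝ)) (hs : ∀ x, 0 < s x) :
    ∃ (N : ℕ) (φ : Fin N → C(X, ℝ)) (p : Fin N → C(↥(cube m), EuclideanSpace ℝ (Fin (2*n+1+m)))),
      (∀ i x, 0 ≤ φ i x) ∧ (∀ x, ∑ i, φ i x ≤ 1) ∧ (∀ i z, p i z ∈ cube (2*n+1+m)) ∧
      (∀ x z, ∑ i, φ i x * ‖p i z - q (x, z)‖ ≤ s x) ∧ (∀ x ∈ A, ∑ i, φ i x = 1) ∧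
      (∀ z, ∀ x ∈ A, ∃ W ∈ ω, ∀ x' ∈ A, ∑ i, φ i x' • p i z = ∑ i, φ i x • p i z → x' ∈ W) := by
  classical
  obtain ⟨s₀, hs₀, hs₀A⟩ := hA.exists_forall_le' (f := s) s.continuous.continuousOn
    (fun x _ => hs x)
  have hW : ∀ x : X, ∃ W ∈ ω, x ∈ W := fun x => by
    have : x ∈ ⋃₀ ω := hω₂ ▸ Set.mem_univ x
    exact this
  choose W hWω hxW using hW
  let qc : C(X, C(↥(cube m), EuclideanSpace ℝ (Fin (2*n+1+m)))) := q.curry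
  let Nb : X → Set X := fun a => {x | dist (qc x) (qc a) < s₀ / 4} ∩ {x | s₀ / 2 < s x} ∩ W a
  have hNo : ∀ a, IsOpen (Nb a) := fun a =>
    ((isOpen_lt (qc.continuous.dist continuous_const) continuous_const).inter
      (isOpen_lt continuous_const s.continuous)).inter (hω₁ _ (hWω a))
  have hNa : ∀ a ∈ A, a ∈ Nb a := fun a ha =>
    ⟨⟨by simpa using hs₀, by have := hs₀A a ha; simp only [Set.mem_ofPred_eq]; linarith⟩, hxW a⟩
  obtain ⟨t, htA, hAt⟩ := hA.elim_nhds_subcover Nb (fun a ha => (hNo a).mem_nhds (hNa a ha))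
  obtain ⟨N, b, hb⟩ : ∃ (N : ℕ) (b : Fin N → X), A ⊆ ⋃ j, Nb (b j) := by
    refine ⟨t.card, fun j => (t.equivFin.symm j : X), fun x hx => ?_⟩
    obtain ⟨a, ha, hxa⟩ := Set.mem_iUnion₂.1 (hAt hx)
    refine Set.mem_iUnion.2 ⟨t.equivFin ⟨a, ha⟩, ?_⟩
    beta_reduce
    rw [Equiv.symm_apply_apply]
    exact hxa
  clear hAt htA
  obtain ⟨V, hVo, hVsub, hVcov, hVcard⟩ := hdim (Fin N) (fun j => Subtype.val ⁻¹' Nb (b j))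
    inferInstance (fun j => (hNo _).preimage continuous_subtype_val) (by
      rw [Set.eq_univ_iff_forall]
      intro x
      obtain ⟨j, hj⟩ := Set.mem_iUnion.1 (hb x.2)
      exact Set.mem_iUnion.2 ⟨j, hj⟩)
  choose O hO hOV using fun j => isOpen_induced_iff.1 (hVo j)
  let U : Fin N → Set X := fun j => O j ∩ Nb (b j)
  have hUV : ∀ j, ∀ x : A, (x : X) ∈ U j → x ∈ V j := by
    intro j x hx
    rw [← hOV j]; exact hx.1
  have hUcov : A ⊆ ⋃ j, U j := by
    intro x hx
    have hxu : (⟨x, hx⟩ : A) ∈ ⋃ i, V i := by rw [hVcov]; exact Set.mem_univ _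
    obtain ⟨j, hj⟩ := Set.mem_iUnion.1 hxu
    have hj' : (⟨x, hx⟩ : A) ∈ Subtype.val ⁻¹' O j := by rw [hOV j]; exact hj
    have h1 : x ∈ O j := hj'
    have hj2 := hVsub j hj
    have h2 : x ∈ Nb (b j) := Set.mem_preimage.1 hj2
    exact Set.mem_iUnion.2 ⟨j, Set.mem_inter h1 h2⟩
  have hUo : ∀ j, IsOpen (U j) := fun j => (hO j).inter (hNo _)
  obtain ⟨φ, hφ⟩ := PartitionOfUnity.exists_isSubordinate hA.isClosed U hUo hUcov
  have hφU : ∀ i x, φ i x ≠ 0 → x ∈ U i := fun i x hx => hφ i (subset_tsupport _ hx)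
  obtain ⟨p, hpc, hpa, hgp⟩ := gp_cube n m (fun j => qc (b j)) (fun j z => hq (b j, z)) (s₀ / 4)
    (by positivity)
  have hle : ∀ x, ∑ i, φ i x ≤ 1 := fun x => by
    have := φ.sum_le_one x
    rwa [finsum_eq_sum_of_fintype] at this
  have hone : ∀ x ∈ A, ∑ i, φ i x = 1 := fun x hx => by
    have := φ.sum_eq_one hx
    rwa [finsum_eq_sum_of_fintype] at this
  refine ⟨N, fun i => φ i, p, fun i x => φ.nonneg i x, hle, hpc, ?_, hone, ?_⟩
  · intro x z
    have key : ∀ i, φ i x * ‖p i z - q (x, z)‖ ≤ φ i x * s x := by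
      intro i
      by_cases h : φ i x = 0
      · simp [h]
      · refine mul_le_mul_of_nonneg_left ?_ (φ.nonneg i x)
        obtain ⟨-, ⟨h1, h2⟩, -⟩ := hφU i x h
        simp only [Set.mem_ofPred_eq] at h1 h2
        have h3 : dist (qc x z) (qc (b i) z) < s₀ / 4 := (ContinuousMap.dist_apply_le_dist z).trans_lt h1
        have h4 := hpa i z
        have h5 : ‖p i z - q (x, z)‖ ≤ ‖p i z - qc (b i) z‖ + ‖qc (b i) z - qc x z‖ :=
          norm_sub_le_norm_sub_add_norm_sub _ _ _
        rw [dist_comm, dist_eq_norm] at h3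
        linarith
    calc _ ≤ ∑ i, φ i x * s x := Finset.sum_le_sum fun i _ => key i
      _ = (∑ i, φ i x) * s x := by rw [Finset.sum_mul]
      _ ≤ 1 * s x := by gcongr; exacts [(hs x).le, hle x]
      _ = s x := one_mul _
  · intro z x hx
    obtain ⟨i, hi⟩ : ∃ i, φ i x ≠ 0 := by
      by_contra! h
      have := hone x hx
      simp [h] at this
    refine ⟨W (b i), hWω _, ?_⟩
    intro x' hx' heq
    let S : A → Finset (Fin N) := fun a => Finset.univ.filter (fun j => a ∈ V j)
    have hScard : ∀ a, (S a).card ≤ n + 1 := by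
      intro a
      have h1 := hVcard a
      have h2 : ({i | a ∈ V i} : Set _).ncard = (S a).card := by
        rw [← Set.ncard_coe_finset]; congr 1; ext j; simp [S]
      rw [h2] at h1
      exact_mod_cast h1
    let T := S ⟨x, hx⟩ ∪ S ⟨x', hx'⟩
    have hTcard : T.card ≤ 2 * n + 2 := by
      have : T.card ≤ _ := Finset.card_union_le (S ⟨x, hx⟩) (S ⟨x', hx'⟩)
      have h1 := hScard ⟨x, hx⟩
      have h2 := hScard ⟨x', hx'⟩
      omega
    have hmem : ∀ a : A, ∀ j, φ j a ≠ 0 → j ∈ S a := fun a j h => by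
      simp only [S, Finset.mem_filter, Finset.mem_univ, true_and]
      exact hUV j a (hφU j a h)
    have hout : ∀ j, j ∉ T → φ j x' - φ j x = 0 := by
      intro j hj
      have h1 : φ j x = 0 := by
        by_contra h
        exact hj (Finset.mem_union_left _ (hmem ⟨x, hx⟩ j h))
      have h2 : φ j x' = 0 := by
        by_contra h
        exact hj (Finset.mem_union_right _ (hmem ⟨x', hx'⟩ j h))
      rw [h1, h2, sub_zero]
    have hz := hgp z (fun j => φ j x' - φ j x) T hTcard (by
      rw [Finset.sum_subset (Finset.subset_univ T) (fun j _ hj => hout j hj),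
        Finset.sum_sub_distrib, hone x hx, hone x' hx', sub_self]) (by
      rw [Finset.sum_subset (Finset.subset_univ T)
        (fun j _ hj => by simp only [hout j hj, zero_smul])]
      simp only [sub_smul]
      rw [Finset.sum_sub_distrib, heq, sub_self]) i (Finset.mem_union_left _ (hmem ⟨x, hx⟩ i hi))
    have hx'i : φ i x' ≠ 0 := by
      intro h
      simp only [h] at hz
      exact hi (by linarith)
    exact (hφU i x' hx'i).2.2

lemma omega_isOpen {X Y Z : Type*} [TopologicalSpace X] [TopologicalSpace Y] [MetricSpace Z]
    (f : X → Y) (y : Y) (hA : IsCompact (f ⁻¹' {y})) (ω : Set (Set X))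
    (g : BoundedContinuousFunction X Z)
    (h : IsOmegaMapOn ω (fun x => (f x, g x)) (f ⁻¹' {y})) :
    ∃ δ > 0, ∀ g' : BoundedContinuousFunction X Z, dist g' g < δ →
      IsOmegaMapOn ω (fun x => (f x, g' x)) (f ⁻¹' {y}) := by
  have h1 : ∀ x : f ⁻¹' {y}, ∃ V : Set Z, IsOpen V ∧ g x ∈ V ∧ ∃ W ∈ ω,
      ∀ x' ∈ f ⁻¹' {y}, g x' ∈ V → x' ∈ W := by
    intro x
    obtain ⟨V, hV, W, hW, hVW⟩ := h x x.2
    have hfx : f x = y := x.2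
    have h2 : {w : Z | (f x, w) ∈ V} ∈ 𝓝 (g x) := by
      exact (Continuous.prodMk_right (f x)).continuousAt hV
    obtain ⟨V', hV', hVo, hgV⟩ := mem_nhds_iff.1 h2
    refine ⟨V', hVo, hgV, W, hW, fun x' hx' hgx' => hVW ⟨hx', ?_⟩⟩
    have : f x' = y := hx'
    change (f x', g x') ∈ V
    rw [this, ← hfx]; exact hV' hgx'
  choose V hVo hgV W hW hVW using h1
  obtain ⟨δ, hδ, hb⟩ := lebesgue_number_lemma_of_metric (hA.image g.continuous) hVo (by
    rintro _ ⟨x, hx, rfl⟩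
    exact mem_iUnion.2 ⟨⟨x, hx⟩, hgV _⟩)
  refine ⟨δ / 4, by positivity, fun g' hg' x hx => ?_⟩
  obtain ⟨i, hi⟩ := hb (g x) (mem_image_of_mem _ hx)
  refine ⟨univ ×ˢ Metric.ball (g' x) (δ / 4),
    prod_mem_nhds Filter.univ_mem (Metric.ball_mem_nhds _ (by positivity)), W i, hW i, ?_⟩
  rintro x' ⟨hx', -, hx'2⟩
  refine hVW i x' hx' (hi ?_)
  have h3 := BoundedContinuousFunction.dist_coe_le_dist (f := g') (g := g) x
  have h4 := BoundedContinuousFunction.dist_coe_le_dist (f := g') (g := g) x'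
  have h5 : dist (g' x') (g' x) < δ / 4 := hx'2
  rw [Metric.mem_ball]
  have h6 := dist_triangle4 (g x') (g' x') (g' x) (g x)
  rw [dist_comm (g x') (g' x')] at h6
  linarith

lemma omega_of_fibers {X Y Z : Type*} [TopologicalSpace X] [TopologicalSpace Y]
    [TopologicalSpace Z] [T2Space Z]
    (f : X → Y) (y : Y) (hA : IsCompact (f ⁻¹' {y})) (ω : Set (Set X))
    (hω₁ : ∀ U ∈ ω, IsOpen U)
    (g : X → Z) (hg : Continuous g)
    (h : ∀ x ∈ f ⁻¹' {y}, ∃ W ∈ ω, ∀ x' ∈ f ⁻¹' {y}, g x' = g x → x' ∈ W) :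
    IsOmegaMapOn ω (fun x => (f x, g x)) (f ⁻¹' {y}) := by
  intro x hx
  obtain ⟨W, hW, hxW⟩ := h x hx
  have hc : IsClosed (g '' (f ⁻¹' {y} \ W)) := ((hA.diff (hω₁ W hW)).image hg).isClosed
  refine ⟨univ ×ˢ (g '' (f ⁻¹' {y} \ W))ᶜ, prod_mem_nhds Filter.univ_mem
    (hc.isOpen_compl.mem_nhds ?_), W, hW, ?_⟩
  · rintro ⟨x', ⟨hx', hx'W⟩, he⟩
    exact hx'W (hxW x' hx' he)
  · rintro x' ⟨hx', -, h2⟩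
    by_contra hn
    exact h2 ⟨x', ⟨hx', hn⟩, rfl⟩

/-- Lemma 2.6. With `f`, `n`, `m`, `k = 2n+1+m`, `ω` as in Theorem 2.1, a
positive continuous `α : X → (0,∞)` and `g₀ ∈ C(X, I^k)`, the set `ψ_ω(y) ∩ B̄(g₀, α)` is a
`Z_m`-set in `B̄(g₀, α)` (a subspace of `C(X, I^k)` with the uniform convergence topology,
realized as the sup-metric space `X →ᵇ I^k` of bounded continuous maps). -/
theorem stmt8 {X Y : Type*} [TopologicalSpace X] [TopologicalSpace Y]
    [T2Space X] [T2Space Y] [ParacompactSpace X] [ParacompactSpace Y]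
    (n m : ℕ) (f : X → Y) (hperf : IsPerfectMap f) (hsurj : Function.Surjective f)
    (hdimf : ∀ y : Y, CovDimLE ↥(f ⁻¹' {y}) n)
    (hdimY : CovDimLE Y m)
    (ω : Set (Set X)) (hω₁ : ∀ U ∈ ω, IsOpen U) (hω₂ : ⋃₀ ω = Set.univ)
    (α : C(X, ℝ)) (hα : ∀ x, 0 < α x)
    (g₀ : BoundedContinuousFunction X ↥(cube (2*n+1+m))) (y : Y) :
    IsZSet m {g : ↥{h : BoundedContinuousFunction X ↥(cube (2*n+1+m)) |
          ∀ x, dist (g₀ x) (h x) ≤ α x} |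
        ¬ IsOmegaMapOn ω (fun x => (f x, (g : BoundedContinuousFunction X ↥(cube (2*n+1+m))) x)
            : X → Y × ↥(cube (2*n+1+m))) (f ⁻¹' {y})} := by
  obtain ⟨-, -, hfib⟩ := hperf
  have hA := hfib y
  constructor
  · rw [← isOpen_compl_iff, Metric.isOpen_iff]
    intro g hg
    have hg' := not_not.1 hg
    obtain ⟨δ, hδ, h⟩ := omega_isOpen f y hA ω g.1 hg'
    refine ⟨δ, hδ, fun g' hg'd => not_not.2 (h _ hg'd)⟩
  · rw [Metric.dense_iff]
    intro u ε hε
    obtain ⟨D, hD0, hD⟩ : ∃ D > 0, ∀ x ∈ cube (2*n+1+m), ∀ x' ∈ cube (2*n+1+m), ‖x - x'‖ ≤ D := by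
      obtain ⟨R, hR0, hR⟩ := (cube_isBounded (2*n+1+m)).exists_pos_norm_le
      exact ⟨R + R, by positivity, fun x hx x' hx' =>
        (norm_sub_le _ _).trans (add_le_add (hR x hx) (hR x' hx'))⟩
    obtain ⟨t, ht0, ht1, htD⟩ : ∃ t : ℝ, 0 < t ∧ t ≤ 1 ∧ t * D ≤ ε / 4 := by
      refine ⟨min 1 (ε / (4 * D)), by positivity, min_le_left _ _, ?_⟩
      calc _ ≤ ε / (4 * D) * D := by gcongr; exact min_le_right _ _
        _ = ε / 4 := by field_simp
    have hucont : Continuous fun w : X × ↥(cube m) =>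
        (u w.2 : BoundedContinuousFunction X ↥(cube (2*n+1+m))) w.1 := by
      have : Continuous fun w : X × ↥(cube m) =>
        ((u w.2 : BoundedContinuousFunction X ↥(cube (2*n+1+m))), w.1) :=
        (continuous_subtype_val.comp (u.continuous.comp continuous_snd)).prodMk continuous_fst
      exact continuous_eval.comp this
    let uu : X → ↥(cube m) → EuclideanSpace ℝ (Fin (2*n+1+m)) := fun x z =>
      ((u z : BoundedContinuousFunction X ↥(cube (2*n+1+m))) x : EuclideanSpace ℝ _)
    have huu : ∀ x z, uu x z ∈ cube (2*n+1+m) := fun x z => Subtype.prop _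
    have huuc : Continuous fun w : X × ↥(cube m) => uu w.1 w.2 :=
      continuous_subtype_val.comp hucont
    let gg : X → EuclideanSpace ℝ (Fin (2*n+1+m)) := fun x => (g₀ x : EuclideanSpace ℝ _)
    have hgg : ∀ x, gg x ∈ cube (2*n+1+m) := fun x => Subtype.prop _
    have hggc : Continuous gg := continuous_subtype_val.comp g₀.continuous
    have hugα : ∀ x z, ‖uu x z - gg x‖ ≤ α x := fun x z => by
      have := (u z).2 x
      rwa [dist_comm, Subtype.dist_eq, dist_eq_norm] at this
    let q : C(X × ↥(cube m), EuclideanSpace ℝ (Fin (2*n+1+m))) :=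
      ⟨fun w => (1 - t) • uu w.1 w.2 + t • gg w.1, by fun_prop⟩
    have hqdef : ∀ x z, q (x, z) = (1 - t) • uu x z + t • gg x := fun _ _ => rfl
    have hqc : ∀ w, q w ∈ cube (2*n+1+m) := fun w =>
      cube_convex _ (huu _ _) (hgg _) (by linarith) ht0.le (by ring)
    let s : C(X, ℝ) := ⟨fun x => min (t * α x) (ε / 4), by fun_prop⟩
    have hs1 : ∀ x, s x ≤ t * α x := fun x => min_le_left _ _
    have hs2 : ∀ x, s x ≤ ε / 4 := fun x => min_le_right _ _
    have hs : ∀ x, 0 < s x := fun x => lt_min (mul_pos ht0 (hα x)) (by positivity)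
    obtain ⟨N, φ, p, hφ0, hφ1, hpc, hclose, hφA, hsep⟩ :=
      density_core n m _ hA (hdimf y) ω hω₁ hω₂ q hqc s hs
    let v : ↥(cube m) → X → EuclideanSpace ℝ (Fin (2*n+1+m)) := fun z x =>
      (1 - ∑ i, φ i x) • q (x, z) + ∑ i, φ i x • p i z
    have hvc : ∀ z x, v z x ∈ cube (2*n+1+m) := by
      intro z x j
      have h1 := hqc (x, z) j
      have h2 : v z x j = (1 - ∑ i, φ i x) * q (x, z) j + ∑ i, φ i x * p i z j := by
        simp [v]
      rw [h2]
      have h3 : 0 ≤ 1 - ∑ i, φ i x := by linarith [hφ1 x]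
      constructor
      · exact add_nonneg (mul_nonneg h3 h1.1)
          (Finset.sum_nonneg fun i _ => mul_nonneg (hφ0 i x) (hpc i z j).1)
      · have h4 : ∑ i, φ i x * p i z j ≤ ∑ i, φ i x :=
          Finset.sum_le_sum fun i _ => mul_le_of_le_one_right (hφ0 i x) (hpc i z j).2
        have h5 : (1 - ∑ i, φ i x) * q (x, z) j ≤ 1 - ∑ i, φ i x :=
          mul_le_of_le_one_right h3 h1.2
        linarith
    have hvcont : ∀ z, Continuous (v z) := by
      intro z
      have : Continuous fun x => q (x, z) := q.continuous.comp (by fun_prop)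
      simp only [v]
      fun_prop
    have hvq : ∀ z x, ‖v z x - q (x, z)‖ ≤ s x := by
      intro z x
      have : v z x - q (x, z) = ∑ i, φ i x • (p i z - q (x, z)) := by
        simp only [v, smul_sub, Finset.sum_sub_distrib, ← Finset.sum_smul]
        module
      rw [this]
      refine (norm_sum_le _ _).trans (le_trans (le_of_eq ?_) (hclose x z))
      refine Finset.sum_congr rfl fun i _ => ?_
      rw [norm_smul, Real.norm_eq_abs, abs_of_nonneg (hφ0 i x)]
    have hvg : ∀ z x, ‖v z x - gg x‖ ≤ α x := by
      intro z x
      have h1 : ‖q (x, z) - gg x‖ ≤ (1 - t) * α x := by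
        have : q (x, z) - gg x = (1 - t) • (uu x z - gg x) := by
          rw [hqdef]; module
        rw [this, norm_smul, Real.norm_eq_abs, abs_of_nonneg (by linarith)]
        exact mul_le_mul_of_nonneg_left (hugα x z) (by linarith)
      have h2 := norm_sub_le_norm_sub_add_norm_sub (v z x) (q (x, z)) (gg x)
      linarith [hvq z x, hs1 x]
    have hvu : ∀ z x, ‖v z x - uu x z‖ ≤ ε / 2 := by
      intro z x
      have h1 : ‖q (x, z) - uu x z‖ ≤ t * D := by
        have : q (x, z) - uu x z = t • (gg x - uu x z) := by
          rw [hqdef]; module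
        rw [this, norm_smul, Real.norm_eq_abs, abs_of_nonneg ht0.le]
        exact mul_le_mul_of_nonneg_left (hD _ (hgg x) _ (huu x z)) ht0.le
      have h2 := norm_sub_le_norm_sub_add_norm_sub (v z x) (q (x, z)) (uu x z)
      linarith [hvq z x, hs2 x]
    let vb : ↥(cube m) → BoundedContinuousFunction X ↥(cube (2*n+1+m)) := fun z =>
      BoundedContinuousFunction.mkOfBound ⟨fun x => ⟨v z x, hvc z x⟩, (hvcont z).subtype_mk _⟩ D
        (fun x x' => by
          rw [Subtype.dist_eq, dist_eq_norm]
          exact hD _ (hvc z x) _ (hvc z x'))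
    have hvb : ∀ z x, ((vb z x : ↥(cube (2*n+1+m))) : EuclideanSpace ℝ _) = v z x :=
      fun _ _ => rfl
    have hvbα : ∀ z x, dist (g₀ x) (vb z x) ≤ α x := fun z x => by
      rw [dist_comm, Subtype.dist_eq, dist_eq_norm]
      exact hvg z x
    have hvbd : ∀ z z', dist (vb z) (vb z') ≤ dist (u z) (u z') + ∑ i, ‖p i z - p i z'‖ := by
      intro z z'
      rw [BoundedContinuousFunction.dist_le (by positivity)]
      intro x
      rw [Subtype.dist_eq, dist_eq_norm, hvb, hvb]
      have e : v z x - v z' x = ((1 - ∑ i, φ i x) * (1 - t)) • (uu x z - uu x z')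
          + ∑ i, φ i x • (p i z - p i z') := by
        simp only [v, hqdef, smul_sub, Finset.sum_sub_distrib]
        module
      rw [e]
      have hφle : ∀ i, φ i x ≤ 1 := fun i =>
        (Finset.single_le_sum (f := fun i => φ i x) (fun j _ => hφ0 j x)
          (Finset.mem_univ i)).trans (hφ1 x)
      have hS0 : 0 ≤ ∑ i, φ i x := Finset.sum_nonneg fun i _ => hφ0 i x
      refine (norm_add_le _ _).trans (add_le_add ?_ ?_)
      · rw [norm_smul, Real.norm_eq_abs,
          abs_of_nonneg (mul_nonneg (by linarith [hφ1 x]) (by linarith))]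
        have h1 : ‖uu x z - uu x z'‖ ≤ dist (u z) (u z') := by
          have := BoundedContinuousFunction.dist_coe_le_dist
            (f := (u z : BoundedContinuousFunction X ↥(cube (2*n+1+m))))
            (g := (u z' : BoundedContinuousFunction X ↥(cube (2*n+1+m)))) x
          rwa [Subtype.dist_eq, dist_eq_norm] at this
        refine le_trans (mul_le_of_le_one_left (norm_nonneg _) ?_) h1
        exact mul_le_one₀ (by linarith) (by linarith) (by linarith)
      · refine (norm_sum_le _ _).trans (Finset.sum_le_sum fun i _ => ?_)
        rw [norm_smul, Real.norm_eq_abs, abs_of_nonneg (hφ0 i x)]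
        exact mul_le_of_le_one_left (norm_nonneg _) (hφle i)
    let w : ↥(cube m) → ↥{h : BoundedContinuousFunction X ↥(cube (2*n+1+m)) |
          ∀ x, dist (g₀ x) (h x) ≤ α x} := fun z => ⟨vb z, hvbα z⟩
    have hw : Continuous w := by
      refine Continuous.subtype_mk ?_ _
      rw [continuous_iff_continuousAt]
      intro z₀
      refine tendsto_iff_dist_tendsto_zero.2 (squeeze_zero (fun _ => dist_nonneg)
        (fun z => hvbd z z₀) ?_)
      have hc : Continuous fun z => dist (u z) (u z₀) + ∑ i, ‖p i z - p i z₀‖ := by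
        have := u.continuous
        fun_prop
      have := hc.tendsto z₀
      simpa using this
    refine ⟨BoundedContinuousFunction.mkOfCompact ⟨w, hw⟩, ?_, ?_⟩
    · rw [Metric.mem_ball]
      refine lt_of_le_of_lt ((BoundedContinuousFunction.dist_le (C := ε / 2)
        (by positivity)).2 fun z => ?_) (by linarith)
      refine (BoundedContinuousFunction.dist_le (by positivity)).2 fun x => ?_
      rw [Subtype.dist_eq, dist_eq_norm]
      exact hvu z x
    · intro z
      refine not_not.2 (omega_of_fibers f y hA ω hω₁ _ (vb z).continuous ?_)
      intro x hx
      obtain ⟨W, hW, h⟩ := hsep z x hx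
      refine ⟨W, hW, fun x' hx' he => h x' hx' ?_⟩
      have h1 : v z x' = v z x := congrArg Subtype.val he
      simp only [v, hφA x hx, hφA x' hx', sub_self, zero_smul, zero_add] at h1
      exact h1
end
end
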